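/- Existence of a volume-preserving circle symmetry near an elliptic axis (Corollary of near-axis Hamada coordinates): Let (B,J,p) be an integrable magnetic field on an open set U ⊆ ℝ³ and let γ ⊆ U be a nondegenerate elliptic magnetic axis. Then there exist an open neighborhood 𝒰 ⊆ U of γ and a C^∞ map T : ℝ × 𝒰 → 𝒰 such that: T(0, z) = z for all z ∈ 𝒰; T(ζ + ζ', z) = T(ζ, T(ζ', z)) for all ζ, ζ' ∈ ℝ and z ∈ 𝒰; T(2π, z) = z for all z ∈ 𝒰; for each ζ the map T(ζ, ·) : 𝒰 → 𝒰 is a diffeomorphism with det(fderiv ℝ (T(ζ,·)) z) = 1 for all z ∈ 𝒰 (volume preservation); and the infinitesimal generator u(z) := (d/dζ) T(ζ, z)|_{ζ=0} is C^∞, nowhere vanishing on 𝒰, and satisfies [u, B] = 0 and [u, J] = 0 on 𝒰. -/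

import Mathlib

noncomputable section

open RealInnerProductSpace

/-- `ℝ³` as a Euclidean space. -/
abbrev R3 : Type := EuclideanSpace ℝ (Fin 3)

/-- The point `(x, y, z)` of `ℝ³`. -/
def pt (x y z : ℝ) : R3 := !₂[x, y, z]

/-- Divergence of a vector field: the trace of its derivative. -/
def divg (v : R3 → R3) (z : R3) : ℝ :=
  LinearMap.trace ℝ R3 (fderiv ℝ v z).toLinearMap

/-- Cross product on `ℝ³`. -/
def cross3 (u v : R3) : R3 :=
  pt (u 1 * v 2 - u 2 * v 1) (u 2 * v 0 - u 0 * v 2) (u 0 * v 1 - u 1 * v 0)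

/-- Standard basis vectors of `ℝ³`. -/
def e3 (i : Fin 3) : R3 := EuclideanSpace.single i 1

/-- Curl of a vector field on `ℝ³`. -/
def curl (v : R3 → R3) (z : R3) : R3 :=
  pt (fderiv ℝ v z (e3 1) 2 - fderiv ℝ v z (e3 2) 1)
     (fderiv ℝ v z (e3 2) 0 - fderiv ℝ v z (e3 0) 2)
     (fderiv ℝ v z (e3 0) 1 - fderiv ℝ v z (e3 1) 0)

/-- The Hessian of `p` at `z`, as a bilinear form. -/
def hess (p : R3 → ℝ) (z : R3) (u v : R3) : ℝ :=
  (iteratedFDeriv ℝ 2 p z) ![u, v]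

/-- `γ` is the image of a periodic integral curve of `B` lying in `U`. -/
def IsPeriodicOrbit (U : Set R3) (B : R3 → R3) (γ : Set R3) : Prop :=
  ∃ (c : ℝ → R3) (T : ℝ), 0 < T ∧ (∀ t, c t ∈ U) ∧
    (∀ t, c (t + T) = c t) ∧ (∀ t, HasDerivAt c (B (c t)) t) ∧ Set.range c = γ

/-- An integrable magnetic field `(B, J, p)` on an open set `U ⊆ ℝ³`. -/
structure IntegrableMagneticField (U : Set R3) (B J : R3 → R3) (p : R3 → ℝ) : Prop where
  isOpen_U : IsOpen U
  smooth_B : ContDiffOn ℝ (⊤ : ℕ∞) B U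
  smooth_J : ContDiffOn ℝ (⊤ : ℕ∞) J U
  smooth_p : ContDiffOn ℝ (⊤ : ℕ∞) p U
  B_ne_zero : ∀ z ∈ U, B z ≠ 0
  div_B : ∀ z ∈ U, divg B z = 0
  div_J : ∀ z ∈ U, divg J z = 0
  hamiltonian : ∀ z ∈ U, cross3 (J z) (B z) = gradient p z

/-- A nondegenerate elliptic magnetic axis: a compact image of a periodic integral
curve of `B` on which `∇p = 0` and the Hessian of `p`, restricted to the plane
orthogonal to `B`, is positive or negative definite. -/
def IsNondegenerateEllipticAxis (U : Set R3) (B : R3 → R3) (p : R3 → ℝ)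
    (γ : Set R3) : Prop :=
  IsCompact γ ∧ γ ⊆ U ∧ IsPeriodicOrbit U B γ ∧
  (∀ z ∈ γ, gradient p z = 0) ∧
  ∀ z ∈ γ,
    (∀ u : R3, u ≠ 0 → ⟪u, B z⟫ = 0 → 0 < hess p z u u) ∨
    (∀ u : R3, u ≠ 0 → ⟪u, B z⟫ = 0 → hess p z u u < 0)

/-- The solid cylinder `D_r × ℝ = {(x,y,φ) : x² + y² < r²}` in `ℝ³`. -/
def Dset (r : ℝ) : Set R3 := {q | (q 0) ^ 2 + (q 1) ^ 2 < r ^ 2}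

section VolterraEquation

open Set Filter Topology MeasureTheory
open scoped unitInterval ContDiff

/-- Pointwise application of a continuous family of continuous linear maps to a continuous map. -/
def ptwiseApply (K E F : Type) [TopologicalSpace K] [CompactSpace K]
    [NormedAddCommGroup E] [NormedSpace ℝ E] [NormedAddCommGroup F] [NormedSpace ℝ F] :
    C(K, E →L[ℝ] F) →L[ℝ] C(K, E) →L[ℝ] C(K, F) :=
  LinearMap.mkContinuous₂
    (LinearMap.mk₂ ℝ (fun (A : C(K, E →L[ℝ] F)) (h : C(K, E)) =>
        (⟨fun k => A k (h k), by fun_prop⟩ : C(K, F)))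
      (fun _ _ _ => by ext; simp) (fun _ _ _ => by ext; simp)
      (fun _ _ _ => by ext; simp) (fun _ _ _ => by ext; simp)) 1 (by
      intro A h
      rw [ContinuousMap.norm_le _ (by positivity)]
      intro k
      rw [one_mul]
      exact (A k).le_of_opNorm_le_of_le (A.norm_coe_le_norm k) (h.norm_coe_le_norm k))

section Nemytskii

variable {K E F : Type} [TopologicalSpace K] [CompactSpace K]
    [NormedAddCommGroup E] [NormedSpace ℝ E] [NormedAddCommGroup F] [NormedSpace ℝ F]

theorem norm_ptwiseApply_le (A : C(K, E →L[ℝ] F)) {C : ℝ} (hC : 0 ≤ C) (hA : ∀ k, ‖A k‖ ≤ C) :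
    ‖ptwiseApply K E F A‖ ≤ C := by
  refine ContinuousLinearMap.opNorm_le_bound _ hC fun h => ?_
  rw [ContinuousMap.norm_le _ (by positivity)]
  intro k
  exact (A k).le_of_opNorm_le_of_le (hA k) (h.norm_coe_le_norm k)

theorem hasFDerivAt_comp_continuousMap {f : E → F} {f' : E → E →L[ℝ] F}
    (hf : ∀ x, HasFDerivAt f (f' x) x) (hc : Continuous f) (hc' : Continuous f') (y : C(K, E)) :
    HasFDerivAt (fun y : C(K, E) => (⟨f, hc⟩ : C(E, F)).comp y)
      (ptwiseApply K E F ((⟨f', hc'⟩ : C(E, E →L[ℝ] F)).comp y)) y := by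
  rw [hasFDerivAt_iff_isLittleO, Asymptotics.isLittleO_iff]
  intro c hc0
  have hS : IsCompact (range y) := isCompact_range y.continuous
  have := hS.uniformContinuousAt_of_continuousAt f' (fun a _ => hc'.continuousAt)
    (Metric.dist_mem_uniformity hc0)
  rw [Metric.mem_uniformity_dist] at this
  obtain ⟨δ, hδ, h⟩ := this
  filter_upwards [Metric.ball_mem_nhds y hδ] with x hx
  rw [ContinuousMap.norm_le _ (by positivity)]
  intro k
  have hk : dist (x k) (y k) < δ := (ContinuousMap.dist_apply_le_dist k).trans_lt hx
  have key := Convex.norm_image_sub_le_of_norm_hasFDerivWithin_le' (f := f) (f' := f')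
    (φ := f' (y k)) (C := c) (s := Metric.ball (y k) δ) (x := y k) (y := x k)
    (fun z _ => (hf z).hasFDerivWithinAt) (fun z hz => by
      have := h (a := y k) (b := z) (by simpa [dist_comm] using hz) ⟨k, rfl⟩
      rw [← dist_eq_norm, dist_comm]
      exact le_of_lt this) (convex_ball _ _) (Metric.mem_ball_self hδ) hk
  refine le_trans key ?_
  gcongr
  exact (x - y).norm_coe_le_norm k

theorem contDiff_comp_continuousMap {f : E → F} (hf : ContDiff ℝ ∞ f) :
    ContDiff ℝ ∞ (fun y : C(K, E) => (⟨f, hf.continuous⟩ : C(E, F)).comp y) := by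
  rw [contDiff_infty]
  intro n
  induction n generalizing F with
  | zero =>
    exact contDiff_zero.2 (ContinuousMap.continuous_postcomp _)
  | succ n ih =>
    have hf' : ContDiff ℝ ∞ (fderiv ℝ f) := hf.fderiv_right (by simp)
    rw [Nat.cast_add, Nat.cast_one, contDiff_succ_iff_hasFDerivAt]
    refine ⟨fun y => ptwiseApply K E F ((⟨fderiv ℝ f, hf'.continuous⟩ : C(E, E →L[ℝ] F)).comp y),
      ContDiff.comp (g := ptwiseApply K E F) (ContinuousLinearMap.contDiff _) (ih hf'), fun y =>
      hasFDerivAt_comp_continuousMap (fun x => (hf.differentiable (by simp) x).hasFDerivAt)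
        hf.continuous hf'.continuous y⟩

end Nemytskii

section Volterra

variable {E : Type} [NormedAddCommGroup E] [NormedSpace ℝ E]

/-- The Volterra operator `y ↦ ∫₀ᵗ y` on continuous maps on the unit interval. -/
def volterra (E : Type) [NormedAddCommGroup E] [NormedSpace ℝ E] : C(I, E) →L[ℝ] C(I, E) :=
  LinearMap.mkContinuous
    { toFun := fun y => ⟨fun t => ∫ s in (0 : ℝ)..t, IccExtend zero_le_one y s,
        (intervalIntegral.continuous_primitive
          (fun a b => (y.continuous.Icc_extend').intervalIntegrable a b) 0).comp
            continuous_subtype_val⟩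
      map_add' := by
        intro x y
        ext t
        simp only [ContinuousMap.coe_mk, ContinuousMap.add_apply]
        rw [← intervalIntegral.integral_add
          ((x.continuous.Icc_extend').intervalIntegrable _ _)
          ((y.continuous.Icc_extend').intervalIntegrable _ _)]
        rfl
      map_smul' := by
        intro c x
        ext t
        simp only [ContinuousMap.coe_mk, ContinuousMap.smul_apply, RingHom.id_apply]
        rw [← intervalIntegral.integral_smul]
        rfl } 1 (by
    intro y
    rw [ContinuousMap.norm_le _ (by positivity)]
    intro t
    have := intervalIntegral.norm_integral_le_of_norm_le_const (a := 0) (b := (t : ℝ))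
      (f := IccExtend zero_le_one y) (C := ‖y‖) (fun x _ => y.norm_coe_le_norm _)
    refine this.trans ?_
    rw [one_mul, sub_zero, abs_of_nonneg t.2.1]
    exact mul_le_of_le_one_right (norm_nonneg _) t.2.2)

theorem volterra_apply (y : C(I, E)) (t : I) :
    volterra E y t = ∫ s in (0 : ℝ)..t, IccExtend zero_le_one y s := rfl

theorem norm_volterra_le : ‖volterra E‖ ≤ 1 :=
  LinearMap.mkContinuous_norm_le _ zero_le_one _

/-- Smooth dependence on parameters of solutions of the integral equation
`y - ∫ f(y) = const (g x)` when the Lipschitz constant of `f` is less than one. -/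
theorem contDiffAt_of_volterra_eq [CompleteSpace E]
    {X : Type} [NormedAddCommGroup X] [NormedSpace ℝ X]
    {f : E → E} (hf : ContDiff ℝ ∞ f) {k : NNReal} (hk : k < 1) (hL : LipschitzWith k f)
    {φ : X → C(I, E)} {g : X → E} {x₀ : X} (hg : ContDiffAt ℝ ∞ g x₀)
    (hφ : ∀ᶠ x in 𝓝 x₀, φ x - volterra E ((⟨f, hf.continuous⟩ : C(E, E)).comp (φ x)) =
      ContinuousMap.const I (g x)) :
    ContDiffAt ℝ ∞ φ x₀ := by
  set Θ : C(I, E) → C(I, E) := fun y => y - volterra E ((⟨f, hf.continuous⟩ : C(E, E)).comp y)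
    with hΘ
  have hΘs : ContDiff ℝ ∞ Θ :=
    contDiff_id.sub ((volterra E).contDiff.comp (contDiff_comp_continuousMap hf))
  have hinj : Function.Injective Θ := by
    intro y y' h
    have h1 : y - y' = volterra E ((⟨f, hf.continuous⟩ : C(E, E)).comp y -
        (⟨f, hf.continuous⟩ : C(E, E)).comp y') := by
      rw [map_sub]
      have h2 : y - volterra E ((⟨f, hf.continuous⟩ : C(E, E)).comp y) =
        y' - volterra E ((⟨f, hf.continuous⟩ : C(E, E)).comp y') := h
      rw [sub_eq_sub_iff_add_eq_add] at h2 ⊢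
      rw [h2, add_comm]
    have h3 : ‖y - y'‖ ≤ k * ‖y - y'‖ := by
      conv_lhs => rw [h1]
      refine ((volterra E).le_of_opNorm_le norm_volterra_le _).trans ?_
      rw [one_mul, ContinuousMap.norm_le _ (by positivity)]
      intro t
      refine (hL.norm_sub_le (y t) (y' t)).trans ?_
      gcongr
      exact (y - y').norm_coe_le_norm t
    have h4 : (k : ℝ) < 1 := by exact_mod_cast hk
    have h5 : ‖y - y'‖ = 0 := by nlinarith [norm_nonneg (y - y')]
    exact sub_eq_zero.1 (norm_eq_zero.1 h5)
  have hf' : ContDiff ℝ ∞ (fderiv ℝ f) := hf.fderiv_right (by simp)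
  set A : C(I, E) →L[ℝ] C(I, E) := (volterra E).comp
    (ptwiseApply I E E ((⟨fderiv ℝ f, hf'.continuous⟩ : C(E, E →L[ℝ] E)).comp (φ x₀))) with hA
  have hAn : ‖A‖ < 1 := by
    refine (ContinuousLinearMap.opNorm_comp_le _ _).trans_lt ?_
    have h1 := norm_ptwiseApply_le
      ((⟨fderiv ℝ f, hf'.continuous⟩ : C(E, E →L[ℝ] E)).comp (φ x₀)) (C := k) k.2
      (fun t => norm_fderiv_le_of_lipschitz ℝ hL)
    have h4 : (k : ℝ) < 1 := by exact_mod_cast hk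
    have := norm_volterra_le (E := E)
    nlinarith [norm_nonneg (volterra E), norm_nonneg (ptwiseApply I E E
      ((⟨fderiv ℝ f, hf'.continuous⟩ : C(E, E →L[ℝ] E)).comp (φ x₀)))]
  set e : C(I, E) ≃L[ℝ] C(I, E) := ContinuousLinearEquiv.ofUnit (Units.oneSub A hAn)
  have hd : HasFDerivAt Θ (e : C(I, E) →L[ℝ] C(I, E)) (φ x₀) := by
    have := (hasFDerivAt_id (φ x₀)).sub ((volterra E).hasFDerivAt.comp (φ x₀)
      (hasFDerivAt_comp_continuousMap (K := I)
        (fun x => (hf.differentiable (by simp) x).hasFDerivAt)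
        hf.continuous hf'.continuous (φ x₀)))
    exact this
  have hat : ContDiffAt ℝ ∞ Θ (φ x₀) := hΘs.contDiffAt
  have hinv := hat.to_localInverse hd (by simp)
  have hr : ∀ᶠ z in 𝓝 (Θ (φ x₀)), Θ (hat.localInverse hd (by simp) z) = z :=
    (hat.hasStrictFDerivAt' hd (by simp)).eventually_right_inverse
  have hconst : ContDiffAt ℝ ∞ (fun x => ContinuousMap.const I (g x)) x₀ := by
    have : (fun x => ContinuousMap.const I (g x)) =
        (ContinuousLinearMap.const ℝ I : E →L[ℝ] C(I, E)) ∘ g := rfl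
    rw [this]
    exact (ContinuousLinearMap.contDiff _).contDiffAt.comp x₀ hg
  have h0 : Θ (φ x₀) = ContinuousMap.const I (g x₀) := hφ.self_of_nhds
  rw [h0] at hinv hr
  have := hinv.comp x₀ hconst
  refine this.congr_of_eventuallyEq ?_
  filter_upwards [hφ, hconst.continuousAt.eventually hr] with x hx hx'
  apply hinj
  rw [Function.comp_apply, hx']
  exact hx

end Volterra

end VolterraEquation

section SmoothFlow

open Set Filter Topology MeasureTheory
open scoped unitInterval ContDiff

section Hadamard

variable {X Y : Type} [NormedAddCommGroup X] [NormedSpace ℝ X]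
  [NormedAddCommGroup Y] [NormedSpace ℝ Y]

theorem contDiff_integral_unitInterval {G : X × ℝ → Y} (hG : ContDiff ℝ ∞ G) :
    ContDiff ℝ ∞ (fun x => ∫ θ in (0 : ℝ)..1, G (x, θ)) := by
  set L : X →L[ℝ] C(I, X × ℝ) :=
    ((ContinuousLinearMap.inl ℝ X ℝ).compLeftContinuous ℝ I).comp
      (ContinuousLinearMap.const ℝ I) with hL
  set c : C(I, X × ℝ) := ⟨fun θ => (0, (θ : ℝ)), by fun_prop⟩ with hc
  have h1 : ContDiff ℝ ∞ (fun x => L x + c) := L.contDiff.add contDiff_const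
  have h2 := (contDiff_comp_continuousMap (K := I) hG).comp h1
  have h3 := (ContinuousLinearMap.contDiff ((ContinuousMap.evalCLM ℝ (1 : I)).comp (volterra Y))
    (n := ∞)).comp h2
  convert h3 using 1
  funext x
  simp only [Function.comp_apply, ContinuousLinearMap.comp_apply, ContinuousMap.evalCLM_apply]
  rw [volterra_apply]
  refine intervalIntegral.integral_congr ?_
  intro θ hθ
  have hθ' : θ ∈ Icc (0 : ℝ) 1 := by simpa using hθ
  simp only [IccExtend_of_mem zero_le_one _ hθ']
  simp [hL, hc]

/-- Hadamard's lemma. -/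
theorem exists_eq_smul_of_contDiff [CompleteSpace Y] {F : X × ℝ → Y} (hF : ContDiff ℝ ∞ F)
    (h0 : ∀ x, F (x, 0) = 0) :
    ∃ G : X × ℝ → Y, ContDiff ℝ ∞ G ∧ (∀ x r, F (x, r) = r • G (x, r)) ∧
      ∀ x, G (x, 0) = fderiv ℝ F (x, 0) (0, 1) := by
  have hF' : ContDiff ℝ ∞ (fderiv ℝ F) := hF.fderiv_right (by simp)
  refine ⟨fun q => ∫ θ in (0 : ℝ)..1, fderiv ℝ F (q.1, θ * q.2) (0, 1), ?_, ?_, ?_⟩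
  · refine contDiff_integral_unitInterval
      (G := fun p : (X × ℝ) × ℝ => fderiv ℝ F (p.1.1, p.2 * p.1.2) (0, 1)) ?_
    refine ContDiff.clm_apply (hF'.comp ?_) contDiff_const
    fun_prop
  · intro x r
    have hd : ∀ θ : ℝ, HasDerivAt (fun θ => F (x, θ * r)) (r • fderiv ℝ F (x, θ * r) (0, 1)) θ := by
      intro θ
      have h1 : HasDerivAt (fun θ : ℝ => (x, θ * r)) ((0 : X), r) θ := by
        simpa using (hasDerivAt_const θ x).prodMk ((hasDerivAt_id θ).mul_const r)
      have := (hF.differentiable (by simp) (x, θ * r)).hasFDerivAt.comp_hasDerivAt θ h1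
      have h2 : ((0 : X), r) = r • ((0 : X), (1 : ℝ)) := by simp
      rw [h2, map_smul] at this
      exact this
    have hcont : Continuous fun θ : ℝ => fderiv ℝ F (x, θ * r) (0, 1) :=
      (hF'.continuous.comp (by fun_prop)).clm_apply continuous_const
    have := intervalIntegral.integral_eq_sub_of_hasDerivAt (a := 0) (b := 1)
      (fun θ _ => hd θ) ((continuous_const.smul hcont).intervalIntegrable _ _)
    rw [intervalIntegral.integral_smul] at this
    simpa [h0] using this.symm
  · intro x
    simp

end Hadamard

section Flow

variable {E : Type} [NormedAddCommGroup E] [NormedSpace ℝ E]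

/-- `Φ` is the complete flow of the vector field `f`. -/
structure IsFlow (f : E → E) (Φ : ℝ → E → E) : Prop where
  zero : ∀ x, Φ 0 x = x
  deriv : ∀ t x, HasDerivAt (fun t => Φ t x) (f (Φ t x)) t

theorem exists_isFlow [CompleteSpace E] {f : E → E} {K : NNReal} (hL : LipschitzWith K f)
    {M : NNReal} (hM : ∀ x, ‖f x‖ ≤ M) : ∃ Φ, IsFlow f Φ := by
  have hex : ∀ (n : ℕ) (x : E), ∃ α : ℝ → E, α 0 = x ∧
      ∀ t ∈ Ioo (-(n : ℝ)) n, HasDerivAt α (f (α t)) t := by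
    intro n x
    have h0 : (0 : ℝ) ∈ Icc (-(n : ℝ)) n := by simp
    have hP : IsPicardLindelof (fun _ => f) (⟨0, h0⟩ : Icc (-(n : ℝ)) n) x (M * n) 0 M K :=
      IsPicardLindelof.of_time_independent (fun x _ => hM x) (hL.lipschitzOnWith) (by simp)
    obtain ⟨α, h1, h2⟩ := hP.exists_eq_forall_mem_Icc_hasDerivWithinAt₀
    exact ⟨α, h1, fun t ht => (h2 t (Ioo_subset_Icc_self ht)).hasDerivAt (Icc_mem_nhds ht.1 ht.2)⟩
  choose α hα0 hα using hex
  have huniq : ∀ (m n : ℕ) (x : E) (t : ℝ), |t| < m → |t| < n → α m x t = α n x t := by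
    have : ∀ (m n : ℕ) (x : E) (t : ℝ), m ≤ n → |t| < m → α m x t = α n x t := by
      intro m n x t hmn ht
      have hm : (m : ℝ) ≤ n := by exact_mod_cast hmn
      have hpos : 0 < (m : ℝ) := (abs_nonneg t).trans_lt ht
      refine ODE_solution_unique_of_mem_Ioo (v := fun _ => f) (s := fun _ => univ) (K := K)
        (a := -(m : ℝ)) (b := m) (t₀ := 0) (fun _ _ => hL.lipschitzOnWith)
        ⟨by linarith, hpos⟩ (fun s hs => ⟨hα m x s hs, mem_univ _⟩)
        (fun s hs => ⟨hα n x s ⟨by linarith [hs.1], by linarith [hs.2]⟩, mem_univ _⟩)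
        (by rw [hα0, hα0]) (abs_lt.1 ht)
    intro m n x t hm hn
    rcases le_total m n with h | h
    · exact this m n x t h hm
    · exact (this n m x t h hn).symm
  have hfl : ∀ t : ℝ, |t| < (⌊|t|⌋₊ + 1 : ℕ) := fun t => by
    push_cast
    exact Nat.lt_floor_add_one _
  refine ⟨fun t x => α (⌊|t|⌋₊ + 1) x t, fun x => hα0 _ _, fun t x => ?_⟩
  have h1 := hα (⌊|t|⌋₊ + 1) x t (abs_lt.1 (hfl t))
  refine h1.congr_of_eventuallyEq ?_
  have : ∀ᶠ s : ℝ in 𝓝 t, |s| < (⌊|t|⌋₊ + 1 : ℕ) :=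
    continuous_abs.continuousAt.eventually_lt continuousAt_const (hfl t)
  filter_upwards [this] with s hs
  exact huniq _ _ _ _ (hfl s) hs

variable {f : E → E} {Φ : ℝ → E → E}

theorem IsFlow.eq_of_hasDerivAt (h : IsFlow f Φ) {K : NNReal} (hL : LipschitzWith K f)
    {c : ℝ → E} (hc : ∀ t, HasDerivAt c (f (c t)) t) (t : ℝ) : c t = Φ t (c 0) := by
  have := ODE_solution_unique_univ (v := fun _ => f) (s := fun _ => univ) (K := K) (t₀ := 0)
    (f := c) (g := fun t => Φ t (c 0)) (fun _ => hL.lipschitzOnWith)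
    (fun s => ⟨hc s, mem_univ _⟩) (fun s => ⟨h.deriv s _, mem_univ _⟩) (h.zero _).symm
  exact congrFun this t

theorem IsFlow.add (h : IsFlow f Φ) {K : NNReal} (hL : LipschitzWith K f) (s t : ℝ) (x : E) :
    Φ (s + t) x = Φ s (Φ t x) := by
  have := h.eq_of_hasDerivAt hL (c := fun s => Φ (s + t) x)
    (fun s => (h.deriv (s + t) x).comp_add_const s t) s
  simpa using this

theorem IsFlow.contDiff [FiniteDimensional ℝ E] (h : IsFlow f Φ) (hf : ContDiff ℝ ∞ f)
    (hc : HasCompactSupport f) : ContDiff ℝ ∞ (fun q : ℝ × E => Φ q.1 q.2) := by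
  have : CompleteSpace E := FiniteDimensional.complete ℝ E
  obtain ⟨K, hL⟩ := hf.lipschitzWith_of_hasCompactSupport hc (by simp)
  let χ : ContDiffBump (0 : ℝ) := ⟨1, 2, by norm_num, by norm_num⟩
  let F0 : ℝ × E → ℝ × E := fun q => (0, (q.1 * χ q.1) • f q.2)
  have hF0 : ContDiff ℝ ∞ F0 := by
    refine contDiff_const.prodMk (ContDiff.smul (contDiff_fst.mul (χ.contDiff.comp contDiff_fst))
      (hf.comp contDiff_snd))
  have hF0c : HasCompactSupport F0 := by
    refine HasCompactSupport.intro (K := Metric.closedBall (0 : ℝ) 2 ×ˢ tsupport f)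
      ((isCompact_closedBall _ _).prod hc) ?_
    intro q hq
    simp only [F0, Prod.mk_eq_zero, true_and]
    by_cases h1 : q.1 ∈ Metric.closedBall (0 : ℝ) 2
    · have h2 : q.2 ∉ tsupport f := fun h2 => hq ⟨h1, h2⟩
      rw [image_eq_zero_of_notMem_tsupport h2, smul_zero]
    · have : χ q.1 = 0 := by
        apply χ.zero_of_le_dist
        have : ¬ dist q.1 0 ≤ 2 := h1
        exact (not_le.1 this).le
      rw [this, mul_zero, zero_smul]
  obtain ⟨K0, hK0⟩ := hF0.lipschitzWith_of_hasCompactSupport hF0c (by simp)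
  obtain ⟨δ, hδ, hδK⟩ : ∃ δ : ℝ, 0 < δ ∧ δ * K0 < 1 := by
    refine ⟨1 / (K0 + 1), by positivity, ?_⟩
    rw [one_div_mul_eq_div, div_lt_one (by positivity)]
    linarith
  let F : ℝ × E → ℝ × E := fun q => δ • F0 q
  have hF : ContDiff ℝ ∞ F := hF0.const_smul δ
  have hFL : LipschitzWith (δ.toNNReal * K0) F := by
    refine LipschitzWith.of_dist_le_mul fun x y => ?_
    rw [dist_eq_norm, ← smul_sub, norm_smul, Real.norm_eq_abs, abs_of_pos hδ, NNReal.coe_mul,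
      Real.coe_toNNReal _ hδ.le, mul_assoc, ← dist_eq_norm]
    gcongr
    exact hK0.dist_le_mul x y
  have hK1 : δ.toNNReal * K0 < 1 := by
    rw [← NNReal.coe_lt_coe, NNReal.coe_mul, Real.coe_toNNReal _ hδ.le]
    simpa using hδK
  have hΦc : ∀ x, Continuous fun t => Φ t x := fun x =>
    continuous_iff_continuousAt.2 fun t => (h.deriv t x).continuousAt
  let φ : ℝ × E → C(I, ℝ × E) := fun q =>
    ⟨fun s => (q.1, Φ (δ * q.1 * s) q.2), by
      refine continuous_const.prodMk ((hΦc q.2).comp ?_)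
      fun_prop⟩
  have hφ : ∀ q : ℝ × E, |q.1| < 1 →
      φ q - volterra (ℝ × E) ((⟨F, hF.continuous⟩ : C(ℝ × E, ℝ × E)).comp (φ q)) =
        ContinuousMap.const I q := by
    intro q hq
    ext1 t
    rw [ContinuousMap.sub_apply, volterra_apply, ContinuousMap.const_apply]
    have hd : ∀ s : ℝ, HasDerivAt (fun s : ℝ => (q.1, Φ (δ * q.1 * s) q.2))
        ((0 : ℝ), (δ * q.1) • f (Φ (δ * q.1 * s) q.2)) s := by
      intro s
      refine (hasDerivAt_const s q.1).prodMk ?_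
      have h1 : HasDerivAt (fun s : ℝ => δ * q.1 * s) (δ * q.1) s := by
        simpa using (hasDerivAt_id s).const_mul (δ * q.1)
      exact (h.deriv (δ * q.1 * s) q.2).scomp s h1
    have hcont : Continuous fun s : ℝ => ((0 : ℝ), (δ * q.1) • f (Φ (δ * q.1 * s) q.2)) := by
      refine continuous_const.prodMk (continuous_const.smul (hf.continuous.comp
        ((hΦc q.2).comp ?_)))
      fun_prop
    have hint := intervalIntegral.integral_eq_sub_of_hasDerivAt (a := 0) (b := (t : ℝ))
      (fun s _ => hd s) (hcont.intervalIntegrable _ _)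
    have hχ : χ q.1 = 1 := by
      apply χ.one_of_mem_closedBall
      simpa [χ] using hq.le
    have hcongr : (∫ s in (0 : ℝ)..t, IccExtend zero_le_one
        ((⟨F, hF.continuous⟩ : C(ℝ × E, ℝ × E)).comp (φ q)) s) =
        ∫ s in (0 : ℝ)..t, ((0 : ℝ), (δ * q.1) • f (Φ (δ * q.1 * s) q.2)) := by
      refine intervalIntegral.integral_congr ?_
      intro s hs
      rw [uIcc_of_le t.2.1] at hs
      have hs' : s ∈ Icc (0 : ℝ) 1 := ⟨hs.1, hs.2.trans t.2.2⟩
      simp only [IccExtend_of_mem zero_le_one _ hs']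
      simp [φ, F, F0, hχ, smul_smul]
    rw [hcongr, hint]
    simp [φ, h.zero]
  have hsmall : ∀ q : ℝ × E, |q.1| < δ → ContDiffAt ℝ ∞ (fun q : ℝ × E => Φ q.1 q.2) q := by
    intro q hq
    have h1 : |δ⁻¹ * q.1| < 1 := by
      rw [abs_mul, abs_of_pos (inv_pos.2 hδ), inv_mul_lt_iff₀ hδ, mul_one]
      exact hq
    have h2 : ContDiffAt ℝ ∞ φ (δ⁻¹ * q.1, q.2) := by
      refine contDiffAt_of_volterra_eq hF hK1 hFL (g := id) contDiffAt_id ?_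
      have : ∀ᶠ p : ℝ × E in 𝓝 (δ⁻¹ * q.1, q.2), |p.1| < 1 :=
        (continuous_abs.comp continuous_fst).continuousAt.eventually_lt continuousAt_const h1
      filter_upwards [this] with p hp
      exact hφ p hp
    have h3 : ContDiffAt ℝ ∞ (fun p : ℝ × E => (δ⁻¹ * p.1, p.2)) q := by fun_prop
    have h4 := (ContinuousLinearMap.contDiff (n := ∞) ((ContinuousLinearMap.snd ℝ ℝ E).comp
      (ContinuousMap.evalCLM ℝ (1 : I)))).contDiffAt.comp q (h2.comp q h3)
    refine h4.congr_of_eventuallyEq (Eventually.of_forall fun p => ?_)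
    simp [φ, mul_inv_cancel_left₀ hδ.ne']
  rw [contDiff_iff_contDiffAt]
  rintro ⟨t, x⟩
  obtain ⟨n, hn⟩ := exists_nat_gt (|t| / δ)
  have hn0 : 0 < (n : ℝ) := lt_of_le_of_lt (by positivity) hn
  have hstep : ∀ k : ℕ, ContDiffAt ℝ ∞ (fun q : ℝ × E => Φ (k * (q.1 / n)) q.2) (t, x) := by
    intro k
    induction k with
    | zero =>
      refine contDiffAt_snd.congr_of_eventuallyEq (Eventually.of_forall fun p => ?_)
      simp [h.zero]
    | succ k ih =>
      have h1 : ContDiffAt ℝ ∞ (fun q : ℝ × E => (q.1 / n, Φ (k * (q.1 / n)) q.2)) (t, x) :=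
        (contDiffAt_fst.div_const _).prodMk ih
      have h2 := (hsmall (t / n, Φ (k * (t / n)) x) (by
        rw [abs_div, abs_of_pos hn0, div_lt_iff₀ hn0, mul_comm]
        exact (div_lt_iff₀ hδ).1 hn)).comp (t, x) h1
      refine h2.congr_of_eventuallyEq (Eventually.of_forall fun p => ?_)
      simp only [Function.comp_apply]
      rw [← h.add hL]
      congr 1
      push_cast
      ring
  refine (hstep n).congr_of_eventuallyEq (Eventually.of_forall fun p => ?_)
  simp only
  rw [mul_div_cancel₀ _ hn0.ne']

end Flow

end SmoothFlow

section CommutingFlows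

open Set Filter Topology
open scoped ContDiff

variable {E : Type} [NormedAddCommGroup E] [NormedSpace ℝ E]

theorem hasFDerivAt_comp_prodMk {F : ℝ × E → E} (hF : ContDiff ℝ ∞ F) (t : ℝ) (x : E) :
    HasFDerivAt (fun x => F (t, x)) ((fderiv ℝ F (t, x)).comp (ContinuousLinearMap.inr ℝ ℝ E)) x :=
  (hF.differentiable (by simp) (t, x)).hasFDerivAt.comp x (hasFDerivAt_prodMk_right t x)

/-- The variational equation of a smooth flow. -/
theorem IsFlow.hasDerivAt_fderiv {f : E → E} {Φ : ℝ → E → E} (h : IsFlow f Φ)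
    (hf : ContDiff ℝ ∞ f) (hΦ : ContDiff ℝ ∞ (fun q : ℝ × E => Φ q.1 q.2)) (t : ℝ) (x v : E) :
    HasDerivAt (fun t => fderiv ℝ (Φ t) x v)
      (fderiv ℝ f (Φ t x) (fderiv ℝ (Φ t) x v)) t := by
  set F : ℝ × E → E := fun q => Φ q.1 q.2 with hF
  have hx : ∀ t x v, fderiv ℝ (Φ t) x v = fderiv ℝ F (t, x) (0, v) := fun t x v => by
    rw [(hasFDerivAt_comp_prodMk hΦ t x).fderiv]
    simp
  have ht : ∀ q, fderiv ℝ F q (1, 0) = f (F q) := by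
    rintro ⟨t, x⟩
    have h1 : HasDerivAt (fun t : ℝ => (t, x)) ((1 : ℝ), (0 : E)) t :=
      (hasDerivAt_id t).prodMk (hasDerivAt_const t x)
    have h2 : HasDerivAt (fun t => Φ t x) (fderiv ℝ F (t, x) (1, 0)) t :=
      HasFDerivAt.comp_hasDerivAt (l := F) t
        (hΦ.differentiable (by simp) (t, x)).hasFDerivAt h1
    exact h2.unique (h.deriv t x)
  have hF' : ContDiff ℝ ∞ (fderiv ℝ F) := hΦ.fderiv_right (by simp)
  have hd2 : ∀ q, HasFDerivAt (fderiv ℝ F) (fderiv ℝ (fderiv ℝ F) q) q := fun q =>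
    (hF'.differentiable (by simp) q).hasFDerivAt
  have hsymm := second_derivative_symmetric (f := F)
    (fun y => (hΦ.differentiable (by simp) y).hasFDerivAt) (hd2 (t, x)) (1, 0) (0, v)
  have h1 : HasDerivAt (fun t : ℝ => (t, x)) ((1 : ℝ), (0 : E)) t :=
    (hasDerivAt_id t).prodMk (hasDerivAt_const t x)
  have h2 : HasDerivAt (fun t => fderiv ℝ F (t, x) (0, v))
      (fderiv ℝ (fderiv ℝ F) (t, x) (1, 0) (0, v)) t :=
    (ContinuousLinearMap.apply ℝ E ((0 : ℝ), v)).hasFDerivAt.comp_hasDerivAt t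
      ((hd2 (t, x)).comp_hasDerivAt t h1)
  have h3 : fderiv ℝ (fderiv ℝ F) (t, x) (0, v) (1, 0) =
      fderiv ℝ f (F (t, x)) (fderiv ℝ F (t, x) (0, v)) := by
    have h4 : HasFDerivAt (fun q => fderiv ℝ F q (1, 0))
        ((ContinuousLinearMap.apply ℝ E ((1 : ℝ), (0 : E))).comp
          (fderiv ℝ (fderiv ℝ F) (t, x))) (t, x) :=
      (ContinuousLinearMap.apply ℝ E ((1 : ℝ), (0 : E))).hasFDerivAt.comp _ (hd2 (t, x))
    have h5 : HasFDerivAt (fun q => f (F q))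
        ((fderiv ℝ f (F (t, x))).comp (fderiv ℝ F (t, x))) (t, x) :=
      (hf.differentiable (by simp) _).hasFDerivAt.comp _
        (hΦ.differentiable (by simp) (t, x)).hasFDerivAt
    have h6 := h4.unique (h5.congr_of_eventuallyEq (Eventually.of_forall ht))
    exact DFunLike.congr_fun h6 (0, v)
  simp only [hx]
  rw [← h3, ← hsymm]
  exact h2

/-- Uniqueness for the linear equation `w' = Df(y) w` along a curve `y`. -/
theorem eq_of_hasDerivAt_fderiv {f : E → E} {K : NNReal} (hL : LipschitzWith K f) {y w w' : ℝ → E}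
    (hw : ∀ t, HasDerivAt w (fderiv ℝ f (y t) (w t)) t)
    (hw' : ∀ t, HasDerivAt w' (fderiv ℝ f (y t) (w' t)) t) (h0 : w 0 = w' 0) (t : ℝ) :
    w t = w' t := by
  refine congrFun (ODE_solution_unique_univ (v := fun t x => fderiv ℝ f (y t) x)
    (s := fun _ => univ) (K := K) (t₀ := 0) (fun t => LipschitzWith.lipschitzOnWith ?_)
    (fun s => ⟨hw s, mem_univ _⟩) (fun s => ⟨hw' s, mem_univ _⟩) h0) t
  refine (fderiv ℝ f (y t)).lipschitz.weaken ?_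
  exact_mod_cast norm_fderiv_le_of_lipschitz ℝ hL

theorem apply_eq_of_fderiv_eq_zero {P : E → ℝ} (hP : Differentiable ℝ P) {f : E → E} {c : ℝ → E}
    (hc : ∀ t, HasDerivAt c (f (c t)) t) (h : ∀ x, fderiv ℝ P x (f x) = 0) (t : ℝ) :
    P (c t) = P (c 0) := by
  have hd : ∀ t, HasDerivAt (fun t => P (c t)) 0 t := fun t => by
    have := (hP (c t)).hasFDerivAt.comp_hasDerivAt t (hc t)
    rwa [h] at this
  exact is_const_of_deriv_eq_zero (fun t => (hd t).differentiableAt) (fun t => (hd t).deriv) t 0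

/-- Two compactly supported commuting vector fields with flows `Φ`, `Ψ` and a common
first integral `P`. -/
structure CommutingPair (B J : E → E) (P : E → ℝ) (Φ Ψ : ℝ → E → E) : Prop where
  smooth_B : ContDiff ℝ ∞ B
  smooth_J : ContDiff ℝ ∞ J
  smooth_P : ContDiff ℝ ∞ P
  compact_B : HasCompactSupport B
  compact_J : HasCompactSupport J
  fderiv_P_B : ∀ z, fderiv ℝ P z (B z) = 0
  fderiv_P_J : ∀ z, fderiv ℝ P z (J z) = 0
  bracket : ∀ z, fderiv ℝ J z (B z) = fderiv ℝ B z (J z)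
  flow_B : IsFlow B Φ
  flow_J : IsFlow J Ψ

namespace CommutingPair

variable {B J : E → E} {P : E → ℝ} {Φ Ψ : ℝ → E → E} (h : CommutingPair B J P Φ Ψ)

include h

theorem symm : CommutingPair J B P Ψ Φ :=
  ⟨h.smooth_J, h.smooth_B, h.smooth_P, h.compact_J, h.compact_B, h.fderiv_P_J, h.fderiv_P_B,
    fun z => (h.bracket z).symm, h.flow_J, h.flow_B⟩

theorem exists_lipschitz : ∃ K, LipschitzWith K B :=
  h.smooth_B.lipschitzWith_of_hasCompactSupport h.compact_B (by simp)

theorem apply_flow (s : ℝ) (x : E) : P (Φ s x) = P x := by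
  have := apply_eq_of_fderiv_eq_zero (h.smooth_P.differentiable (by simp))
    (fun t => h.flow_B.deriv t x) h.fderiv_P_B s
  rwa [h.flow_B.zero] at this

theorem fderiv_flow_zero (x v : E) : fderiv ℝ (Φ 0) x v = v := by
  have : Φ 0 = id := funext h.flow_B.zero
  rw [this, fderiv_id]
  rfl

theorem flow_add (s t : ℝ) (x : E) : Φ (s + t) x = Φ s (Φ t x) :=
  let ⟨_, hK⟩ := h.exists_lipschitz
  h.flow_B.add hK s t x

theorem apply_action (s t : ℝ) (z : E) : P (Φ s (Ψ t z)) = P z := by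
  rw [h.apply_flow, h.symm.apply_flow]

variable [FiniteDimensional ℝ E]

theorem contDiff_flow : ContDiff ℝ ∞ (fun q : ℝ × E => Φ q.1 q.2) :=
  h.flow_B.contDiff h.smooth_B h.compact_B

theorem differentiable_flow (s : ℝ) : Differentiable ℝ (Φ s) := fun x =>
  (hasFDerivAt_comp_prodMk h.contDiff_flow s x).differentiableAt

theorem fderiv_flow_apply (s : ℝ) (z : E) : fderiv ℝ (Φ s) z (J z) = J (Φ s z) := by
  obtain ⟨K, hK⟩ := h.exists_lipschitz
  refine eq_of_hasDerivAt_fderiv hK (y := fun s => Φ s z)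
    (w := fun s => fderiv ℝ (Φ s) z (J z)) (w' := fun s => J (Φ s z))
    (fun t => h.flow_B.hasDerivAt_fderiv h.smooth_B h.contDiff_flow t z _) (fun t => ?_) ?_ s
  · rw [← h.bracket]
    exact (h.smooth_J.differentiable (by simp) _).hasFDerivAt.comp_hasDerivAt t (h.flow_B.deriv t z)
  · simp only [h.fderiv_flow_zero, h.flow_B.zero]

theorem flow_comm (s t : ℝ) (z : E) : Φ s (Ψ t z) = Ψ t (Φ s z) := by
  obtain ⟨K, hK⟩ := h.symm.exists_lipschitz
  have := h.flow_J.eq_of_hasDerivAt hK (c := fun t => Φ s (Ψ t z)) (fun t => by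
    rw [← h.fderiv_flow_apply]
    exact (h.differentiable_flow s _).hasFDerivAt.comp_hasDerivAt t (h.flow_J.deriv t z)) t
  simpa [h.flow_J.zero] using this

/-- The joint action of the two flows. -/
theorem action_add (s s' t t' : ℝ) (z : E) :
    Φ (s + s') (Ψ (t + t') z) = Φ s (Ψ t (Φ s' (Ψ t' z))) := by
  rw [h.flow_add, h.symm.flow_add, h.flow_comm s' t]

theorem contDiff_action : ContDiff ℝ ∞ (fun q : ℝ × ℝ × E => Φ q.1 (Ψ q.2.1 q.2.2)) :=
  h.contDiff_flow.comp (contDiff_fst.prodMk (h.symm.contDiff_flow.comp contDiff_snd))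

end CommutingPair

end CommutingFlows

section ImplicitFunction

open Set Filter Topology
open scoped ContDiff

variable {E₁ E₂ F : Type} [NormedAddCommGroup E₁] [NormedSpace ℝ E₁] [CompleteSpace E₁]
  [NormedAddCommGroup E₂] [NormedSpace ℝ E₂] [CompleteSpace E₂]
  [NormedAddCommGroup F] [NormedSpace ℝ F] [CompleteSpace F]

/-- The implicit function theorem, with smoothness on a neighbourhood of the base point. -/
theorem exists_smooth_implicitFunction {f : E₁ × E₂ → F} {u : E₁ × E₂}
    (hf : ∀ᶠ v in 𝓝 u, ContDiffAt ℝ ∞ f v)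
    (hu : (fderiv ℝ f u ∘L .inr ℝ E₁ E₂).IsInvertible) :
    ∃ ψ : E₁ → E₂, ψ u.1 = u.2 ∧ (∀ᶠ x in 𝓝 u.1, ContDiffAt ℝ ∞ ψ x) ∧
      (∀ᶠ x in 𝓝 u.1, f (x, ψ x) = f u) ∧ ∀ᶠ v in 𝓝 u, f v = f u → ψ v.1 = v.2 := by
  have hfu := hf.self_of_nhds
  have hn : (∞ : WithTop ℕ∞) ≠ 0 := by simp
  set ψ := hfu.implicitFunction hn hu with hψ
  have h0 : ψ u.1 = u.2 := hfu.implicitFunction_apply_self hn hu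
  have h1 : ∀ᶠ x in 𝓝 u.1, f (x, ψ x) = f u := hfu.eventually_apply_implicitFunction hn hu
  have hsm : ContDiffAt ℝ ∞ ψ u.1 := hfu.contDiffAt_implicitFunction hn hu
  refine ⟨ψ, h0, ?_, h1, ?_⟩
  · have hc : Tendsto (fun x => (x, ψ x)) (𝓝 u.1) (𝓝 u) := by
      have : ContinuousAt (fun x => (x, ψ x)) u.1 := continuousAt_id.prodMk hsm.continuousAt
      have h2 : (u.1, ψ u.1) = u := by rw [h0]
      simpa only [ContinuousAt, h2] using this
    have hinv : ∀ᶠ v in 𝓝 u, (fderiv ℝ f v ∘L .inr ℝ E₁ E₂).IsInvertible := by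
      have hcont : ContinuousAt (fun v => fderiv ℝ f v ∘L .inr ℝ E₁ E₂) u := by
        refine ContinuousAt.clm_comp ?_ continuousAt_const
        exact (hfu.fderiv_right (m := 0) (by simp)).continuousAt
      obtain ⟨A, hA⟩ := hu
      have hmem : range ((↑) : (E₂ ≃L[ℝ] F) → E₂ →L[ℝ] F) ∈ 𝓝 (fderiv ℝ f u ∘L .inr ℝ E₁ E₂) := by
        rw [← hA]
        exact A.nhds
      filter_upwards [hcont hmem] with v hv
      obtain ⟨A', hA'⟩ := hv
      exact ⟨A', hA'⟩
    have hψc : ∀ᶠ x in 𝓝 u.1, ContinuousAt ψ x := by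
      have : ContDiffAt ℝ 1 ψ u.1 := hsm.of_le (by simp)
      filter_upwards [this.eventually (by simp)] with x hx using hx.continuousAt
    filter_upwards [hc.eventually hf, hc.eventually hinv, hψc, h1,
      eventually_eventually_nhds.2 h1] with x hx1 hx2 hx3 hx4 hx5
    have hA := hx1.contDiffAt_implicitFunction hn hx2
    refine hA.congr_of_eventuallyEq ?_
    have hB := hx1.eventually_apply_eq_iff_implicitFunction hn hx2
    have hC : Tendsto (fun x => (x, ψ x)) (𝓝 x) (𝓝 (x, ψ x)) :=
      continuousAt_id.prodMk hx3
    filter_upwards [hC.eventually hB, hx5] with y hy hy5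
    exact (hy.1 (hy5.trans hx4.symm)).symm
  · filter_upwards [hfu.eventually_apply_eq_iff_implicitFunction hn hu] with v hv using hv.1

end ImplicitFunction

section EllipticFrame

open Set Filter Topology
open scoped ContDiff

variable {E : Type} [NormedAddCommGroup E] [NormedSpace ℝ E]

theorem CommutingPair.hasFDerivAt_flow [FiniteDimensional ℝ E] {B J : E → E} {P : E → ℝ} {Φ Ψ : ℝ → E → E}
    (h : CommutingPair B J P Φ Ψ) (t : ℝ) (x : E) :
    HasFDerivAt (fun q : ℝ × E => Φ q.1 q.2)
      ((ContinuousLinearMap.fst ℝ ℝ E).smulRight (B (Φ t x)) +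
        (fderiv ℝ (Φ t) x).comp (ContinuousLinearMap.snd ℝ ℝ E)) (t, x) := by
  have hd := (h.contDiff_flow.differentiable (by simp) (t, x)).hasFDerivAt
  set D := fderiv ℝ (fun q : ℝ × E => Φ q.1 q.2) (t, x) with hD
  have h1 : D (1, 0) = B (Φ t x) := by
    have h2 : HasDerivAt (fun t : ℝ => (t, x)) ((1 : ℝ), (0 : E)) t :=
      (hasDerivAt_id t).prodMk (hasDerivAt_const t x)
    have h3 : HasDerivAt (fun t => Φ t x) (D (1, 0)) t :=
      HasFDerivAt.comp_hasDerivAt (l := fun q : ℝ × E => Φ q.1 q.2) t hd h2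
    exact h3.unique (h.flow_B.deriv t x)
  have h2 : fderiv ℝ (Φ t) x = D.comp (ContinuousLinearMap.inr ℝ ℝ E) :=
    (hasFDerivAt_comp_prodMk h.contDiff_flow t x).fderiv
  have h3 : (ContinuousLinearMap.fst ℝ ℝ E).smulRight (B (Φ t x)) +
      (fderiv ℝ (Φ t) x).comp (ContinuousLinearMap.snd ℝ ℝ E) = D := by
    ext <;> simp [h1, h2, Prod.mk_zero_zero]
  rw [h3]
  exact hd

/-- A frame at a point `z₀` of an elliptic periodic orbit of `B` on which `J` vanishes. -/
structure EllipticFrame (B J : E → E) (P : E → ℝ) (Φ : ℝ → E → E) (z₀ : E) (T ν θ : ℝ)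
    (e e₂ : E) (π₁ π₂ πb : E →L[ℝ] ℝ) : Prop where
  decomp : ∀ v, v = π₁ v • e + π₂ v • e₂ + πb v • B z₀
  coords : π₁ e = 1 ∧ π₂ e = 0 ∧ πb e = 0 ∧ π₁ e₂ = 0 ∧ π₂ e₂ = 1 ∧ πb e₂ = 0 ∧
    π₁ (B z₀) = 0 ∧ π₂ (B z₀) = 0 ∧ πb (B z₀) = 1
  ν_pos : 0 < ν
  T_pos : 0 < T
  J_eq_zero : J z₀ = 0
  fderiv_J_e : fderiv ℝ J z₀ e = ν • e₂
  fderiv_J_e₂ : fderiv ℝ J z₀ e₂ = -(ν • e)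
  periodic : Φ T z₀ = z₀
  monodromy : fderiv ℝ (Φ T) z₀ e = Real.cos θ • e + Real.sin θ • e₂
  P_eq_zero : P z₀ = 0
  P_nonneg : ∀ z, 0 ≤ P z
  fderiv_P : fderiv ℝ P z₀ = 0
  hess_pos : 0 < fderiv ℝ (fderiv ℝ P) z₀ e e

namespace EllipticFrame

variable {B J : E → E} {P : E → ℝ} {Φ Ψ : ℝ → E → E} {z₀ : E} {T ν θ : ℝ} {e e₂ : E}
  {π₁ π₂ πb : E →L[ℝ] ℝ} (h : CommutingPair B J P Φ Ψ)
  (hF : EllipticFrame B J P Φ z₀ T ν θ e e₂ π₁ π₂ πb)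

include h hF

theorem flow_J_base (t : ℝ) : Ψ t z₀ = z₀ := by
  obtain ⟨K, hK⟩ := h.symm.exists_lipschitz
  exact (h.flow_J.eq_of_hasDerivAt hK (c := fun _ => z₀) (fun t => by
    rw [hF.J_eq_zero]; exact hasDerivAt_const t z₀) t).symm

variable [FiniteDimensional ℝ E]

theorem fderiv_flow_J (t φ : ℝ) :
    fderiv ℝ (Ψ t) z₀ (Real.cos φ • e + Real.sin φ • e₂) =
      Real.cos (ν * t + φ) • e + Real.sin (ν * t + φ) • e₂ := by
  obtain ⟨K, hK⟩ := h.symm.exists_lipschitz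
  refine eq_of_hasDerivAt_fderiv hK (y := fun _ => z₀)
    (w := fun t => fderiv ℝ (Ψ t) z₀ (Real.cos φ • e + Real.sin φ • e₂))
    (w' := fun t => Real.cos (ν * t + φ) • e + Real.sin (ν * t + φ) • e₂)
    (fun t => ?_) (fun t => ?_) ?_ t
  · have := h.flow_J.hasDerivAt_fderiv h.smooth_J h.symm.contDiff_flow t z₀
      (Real.cos φ • e + Real.sin φ • e₂)
    rwa [hF.flow_J_base h] at this
  · have h1 : HasDerivAt (fun t => ν * t + φ) ν t := by
      simpa using ((hasDerivAt_id t).const_mul ν).add_const φ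
    have h2 := (h1.cos.smul_const e).add (h1.sin.smul_const e₂)
    refine h2.congr_deriv ?_
    rw [map_add, map_smul, map_smul, hF.fderiv_J_e, hF.fderiv_J_e₂]
    module
  · rw [h.symm.fderiv_flow_zero]
    simp

/-- Straightening near the orbit after blowing up: a point `z₀ + r v` with `v` close to the unit
circle is moved by the joint action to the ray `z₀ + ℝ e`, in a unique way and smoothly. -/
theorem exists_blowup (t₀ : ℝ) {v₀ : E}
    (hv₀ : v₀ = Real.cos (-(ν * t₀)) • e + Real.sin (-(ν * t₀)) • e₂) :
    ∃ (w : E × ℝ → ℝ × ℝ) (k : E × ℝ → ℝ), w (v₀, 0) = (0, t₀) ∧ k (v₀, 0) = 1 ∧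
      (∀ᶠ q in 𝓝 (v₀, (0 : ℝ)), ContDiffAt ℝ ∞ w q) ∧
      ContinuousAt k (v₀, 0) ∧
      (∀ᶠ q in 𝓝 (v₀, (0 : ℝ)), Φ (q.2 * (w q).1) (Ψ (w q).2 (z₀ + q.2 • q.1)) =
        z₀ + (q.2 * k q) • e) ∧
      ∀ᶠ x in 𝓝 ((v₀, (0 : ℝ)), ((0 : ℝ), t₀)), x.1.2 ≠ 0 → ∀ c : ℝ,
        Φ (x.1.2 * x.2.1) (Ψ x.2.2 (z₀ + x.1.2 • x.1.1)) = z₀ + c • e → w x.1 = x.2 := by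
  obtain ⟨c1, c2, c3, c4, c5, c6, c7, c8, c9⟩ := hF.coords
  let F : (E × (ℝ × ℝ)) × ℝ → E := fun x =>
    Φ (x.2 * x.1.2.1) (Ψ x.1.2.2 (z₀ + x.2 • x.1.1)) - z₀
  have hFs : ContDiff ℝ ∞ F := by
    have : ContDiff ℝ ∞ (fun x : (E × (ℝ × ℝ)) × ℝ =>
        (x.2 * x.1.2.1, x.1.2.2, z₀ + x.2 • x.1.1)) := by fun_prop
    exact (h.contDiff_action.comp this).sub contDiff_const
  obtain ⟨G, hG, hFG, hG0⟩ := exists_eq_smul_of_contDiff hFs (fun x => by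
    simp [F, hF.flow_J_base h, h.flow_B.zero])
  have hG0' : ∀ v s t, G ((v, (s, t)), 0) = s • B z₀ + fderiv ℝ (Ψ t) z₀ v := by
    intro v s t
    rw [hG0]
    have hline : HasDerivAt (fun r : ℝ => (((v, (s, t)), r) : (E × (ℝ × ℝ)) × ℝ)) (0, 1) 0 :=
      (hasDerivAt_const _ _).prodMk (hasDerivAt_id _)
    have h1 : HasDerivAt (fun r : ℝ => F ((v, (s, t)), r)) (fderiv ℝ F ((v, (s, t)), 0) (0, 1)) 0 :=
      HasFDerivAt.comp_hasDerivAt (l := F) 0 (hFs.differentiable (by simp) _).hasFDerivAt hline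
    refine h1.unique ?_
    have h2 : HasDerivAt (fun r : ℝ => z₀ + r • v) v 0 := by
      simpa using ((hasDerivAt_id (0 : ℝ)).smul_const v).const_add z₀
    have h3 : HasDerivAt (fun r : ℝ => Ψ t (z₀ + r • v)) (fderiv ℝ (Ψ t) z₀ v) 0 := by
      refine HasFDerivAt.comp_hasDerivAt (l := Ψ t) 0 ?_ h2
      simpa using (h.symm.differentiable_flow t (z₀ + (0 : ℝ) • v)).hasFDerivAt
    have h4 : HasDerivAt (fun r : ℝ => (r * s, Ψ t (z₀ + r • v)))
        (s, fderiv ℝ (Ψ t) z₀ v) 0 :=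
      (by simpa using (hasDerivAt_id (0 : ℝ)).mul_const s : HasDerivAt (fun r : ℝ => r * s) s 0).prodMk h3
    have h5 := h.hasFDerivAt_flow 0 z₀
    have h6 : HasDerivAt (fun r : ℝ => Φ (r * s) (Ψ t (z₀ + r • v)))
        (((ContinuousLinearMap.fst ℝ ℝ E).smulRight (B (Φ 0 z₀)) +
        (fderiv ℝ (Φ 0) z₀).comp (ContinuousLinearMap.snd ℝ ℝ E)) (s, fderiv ℝ (Ψ t) z₀ v)) 0 := by
      refine HasFDerivAt.comp_hasDerivAt (l := fun q : ℝ × E => Φ q.1 q.2) 0 ?_ h4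
      simpa [hF.flow_J_base h] using h5
    have h7 := h6.sub_const z₀
    refine h7.congr_deriv ?_
    simp [h.flow_B.zero, h.fderiv_flow_zero]
  let f : (E × ℝ) × (ℝ × ℝ) → ℝ × ℝ := fun x =>
    (πb (G ((x.1.1, x.2), x.1.2)), π₂ (G ((x.1.1, x.2), x.1.2)))
  have hf : ContDiff ℝ ∞ f := by
    have hi : ContDiff ℝ ∞ (fun x : (E × ℝ) × (ℝ × ℝ) => G ((x.1.1, x.2), x.1.2)) :=
      hG.comp (by fun_prop)
    exact (πb.contDiff.comp hi).prodMk (π₂.contDiff.comp hi)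
  set u : (E × ℝ) × (ℝ × ℝ) := ((v₀, 0), (0, t₀)) with hu
  have hf0 : ∀ s t, f ((v₀, 0), (s, t)) = (s, Real.sin (ν * t + -(ν * t₀))) := by
    intro s t
    simp only [f]
    rw [hG0', hv₀, hF.fderiv_flow_J h]
    simp [c2, c3, c5, c6, c8, c9]
  have hfu : f u = 0 := by
    rw [hu, hf0]
    simp
  have hinv : (fderiv ℝ f u ∘L .inr ℝ (E × ℝ) (ℝ × ℝ)).IsInvertible := by
    refine ⟨(ContinuousLinearEquiv.refl ℝ ℝ).prodCongr
      (ContinuousLinearEquiv.unitsEquivAut ℝ (Units.mk0 ν hF.ν_pos.ne')), ?_⟩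
    have h1 : HasFDerivAt (fun y : ℝ × ℝ => f ((v₀, 0), y))
        (fderiv ℝ f u ∘L .inr ℝ (E × ℝ) (ℝ × ℝ)) (0, t₀) :=
      (hf.differentiable (by simp) u).hasFDerivAt.comp _ (hasFDerivAt_prodMk_right _ _)
    refine HasFDerivAt.unique ?_ h1
    have h2 : (fun y : ℝ × ℝ => f ((v₀, 0), y)) =
        fun y => (y.1, Real.sin (ν * y.2 + -(ν * t₀))) := by
      funext ⟨s, t⟩
      exact hf0 s t
    rw [h2]
    have h3 : HasDerivAt (fun t => Real.sin (ν * t + -(ν * t₀))) ν t₀ := by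
      have h4 : HasDerivAt (fun t => ν * t + -(ν * t₀)) ν t₀ := by
        simpa using ((hasDerivAt_id t₀).const_mul ν).add_const (-(ν * t₀))
      simpa using h4.sin
    have h5 : HasFDerivAt (fun y : ℝ × ℝ => Real.sin (ν * y.2 + -(ν * t₀)))
        ((ContinuousLinearMap.toSpanSingleton ℝ ν).comp (ContinuousLinearMap.snd ℝ ℝ ℝ))
        ((0 : ℝ), t₀) :=
      HasFDerivAt.comp (g := fun t => Real.sin (ν * t + -(ν * t₀))) ((0 : ℝ), t₀) h3.hasFDerivAt
        hasFDerivAt_snd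
    have h6 : HasFDerivAt (fun y : ℝ × ℝ => (y.1, Real.sin (ν * y.2 + -(ν * t₀))))
        ((ContinuousLinearMap.fst ℝ ℝ ℝ).prod
        ((ContinuousLinearMap.toSpanSingleton ℝ ν).comp (ContinuousLinearMap.snd ℝ ℝ ℝ)))
        ((0 : ℝ), t₀) := hasFDerivAt_fst.prodMk h5
    convert h6 using 1
    ext <;> simp
  obtain ⟨w, hw0, hws, hwf, hwu⟩ := exists_smooth_implicitFunction
    (Eventually.of_forall fun v => hf.contDiffAt) hinv
  have hw0' : w (v₀, 0) = (0, t₀) := hw0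
  refine ⟨w, fun q => π₁ (G ((q.1, w q), q.2)), hw0', ?_, hws, ?_, ?_, ?_⟩
  · simp only [hw0']
    rw [hG0', hv₀, hF.fderiv_flow_J h]
    simp [c1]
  · have hc := hws.self_of_nhds.continuousAt
    refine π₁.continuous.continuousAt.comp (hG.continuous.continuousAt.comp ?_)
    exact (continuousAt_fst.prodMk hc).prodMk continuousAt_snd
  · filter_upwards [hwf] with q hq
    rw [hfu] at hq
    have h1 := congrArg Prod.fst hq
    have h2 := congrArg Prod.snd hq
    simp only [f, Prod.fst_zero, Prod.snd_zero] at h1 h2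
    have h3 := hF.decomp (G ((q.1, w q), q.2))
    rw [h1, h2, zero_smul, zero_smul, add_zero, add_zero] at h3
    have h4 := hFG (q.1, w q) q.2
    simp only [F] at h4
    rw [sub_eq_iff_eq_add'] at h4
    rw [h4, mul_smul, ← h3]
  · filter_upwards [hwu] with x hx hx0 c hc
    refine hx ?_
    rw [hfu]
    have h4 := hFG (x.1.1, x.2) x.1.2
    simp only [F] at h4
    rw [hc, add_sub_cancel_left] at h4
    have h5 : G ((x.1.1, x.2), x.1.2) = (x.1.2⁻¹ * c) • e := by
      rw [mul_smul, h4, smul_smul, inv_mul_cancel₀ hx0, one_smul]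
    simp only [f, h5, map_smul, c2, c3, smul_zero]
    rfl

end EllipticFrame

end EllipticFrame

section MorseLemma

open Set Filter Topology
open scoped ContDiff

theorem exists_eq_mul_of_contDiff {g : ℝ → ℝ} (hg : ContDiff ℝ ∞ g) (h0 : g 0 = 0) :
    ∃ q : ℝ → ℝ, ContDiff ℝ ∞ q ∧ ∀ r, g r = r * q r := by
  obtain ⟨G, hG, hG1, -⟩ := exists_eq_smul_of_contDiff (X := ℝ) (Y := ℝ)
    (F := fun x => g x.2) (hg.comp contDiff_snd) (fun _ => h0)
  exact ⟨fun r => G (0, r), hG.comp (by fun_prop), fun r => hG1 0 r⟩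

/-- The Morse lemma in dimension one: near a nondegenerate minimum `φ` is the square of a
local coordinate `S`, with smooth inverse `R`. -/
theorem exists_sq_coordinate {φ φ' : ℝ → ℝ} {c : ℝ} (hφ : ContDiff ℝ ∞ φ) (h0 : φ 0 = 0)
    (hd : ∀ r, HasDerivAt φ (φ' r) r) (h1 : φ' 0 = 0) (h2 : HasDerivAt φ' c 0) (hc : 0 < c) :
    ∃ S R : ℝ → ℝ, S 0 = 0 ∧ R 0 = 0 ∧ ContinuousAt S 0 ∧ (∀ᶠ ρ in 𝓝 0, ContDiffAt ℝ ∞ R ρ) ∧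
      (∀ᶠ r in 𝓝 0, φ r = S r ^ 2) ∧ (∀ᶠ r in 𝓝 0, R (S r) = r) ∧ (∀ᶠ ρ in 𝓝 0, S (R ρ) = ρ) ∧
      (∀ r, 0 ≤ r → 0 ≤ S r) ∧ (∀ r, r ≤ 0 → S r ≤ 0) ∧
      ∃ d, d ≠ 0 ∧ HasDerivAt R d 0 := by
  obtain ⟨g, hg, hgφ⟩ := exists_eq_mul_of_contDiff hφ h0
  have hg0 : g 0 = 0 := by
    have h3 : HasDerivAt (fun r => r * g r) (1 * g 0 + 0 * deriv g 0) 0 :=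
      (hasDerivAt_id 0).mul ((hg.differentiable (by simp) 0).hasDerivAt)
    have h4 := h3.unique ((hd 0).congr_of_eventuallyEq (Eventually.of_forall fun r => (hgφ r).symm))
    rw [h1] at h4
    linarith
  obtain ⟨q, hq, hqg⟩ := exists_eq_mul_of_contDiff hg hg0
  have hq' : ContDiff ℝ ∞ (deriv q) := (contDiff_infty_iff_deriv.1 hq).2
  have hqd : ∀ r, HasDerivAt q (deriv q r) r := fun r => (hq.differentiable (by simp) r).hasDerivAt
  have hφ' : ∀ r, φ' r = r * (2 * q r + r * deriv q r) := by
    intro r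
    have h3 : HasDerivAt (fun r => r * (r * q r))
        (1 * (r * q r) + r * (1 * q r + r * deriv q r)) r :=
      (hasDerivAt_id r).mul ((hasDerivAt_id r).mul (hqd r))
    have h4 := h3.unique ((hd r).congr_of_eventuallyEq (Eventually.of_forall fun r => by
      simp only [hgφ, hqg]))
    rw [← h4]
    ring
  have hq0 : 0 < q 0 := by
    have h3 : DifferentiableAt ℝ (fun r => 2 * q r + r * deriv q r) 0 :=
      ((hqd 0).differentiableAt.const_mul 2).add
        (differentiableAt_id.mul (hq'.differentiable (by simp) 0))
    have h4 := (hasDerivAt_id (0 : ℝ)).mul h3.hasDerivAt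
    have h5 := h4.unique (h2.congr_of_eventuallyEq (Eventually.of_forall fun r => (hφ' r).symm))
    simp at h5
    linarith
  have hqpos : ∀ᶠ r in 𝓝 (0 : ℝ), 0 < q r := continuousAt_const.eventually_lt
    hq.continuous.continuousAt hq0
  let S : ℝ → ℝ := fun r => r * Real.sqrt (q r)
  have hSsm : ∀ r, 0 < q r → ContDiffAt ℝ ∞ S r := fun r hr =>
    contDiffAt_id.mul (hq.contDiffAt.sqrt hr.ne')
  have hSd : HasDerivAt S (Real.sqrt (q 0)) 0 := by
    have h3 : DifferentiableAt ℝ (fun r => Real.sqrt (q r)) 0 :=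
      (hqd 0).differentiableAt.sqrt hq0.ne'
    have h4 := (hasDerivAt_id (0 : ℝ)).mul h3.hasDerivAt
    refine HasDerivAt.congr_deriv (f := S) h4 ?_
    simp
  have hsq : Real.sqrt (q 0) ≠ 0 := (Real.sqrt_pos.2 hq0).ne'
  have hS0 : S 0 = 0 := by simp [S]
  let f : ℝ × ℝ → ℝ := fun x => S x.2 - x.1
  have hf : ∀ᶠ x in 𝓝 ((0 : ℝ), (0 : ℝ)), ContDiffAt ℝ ∞ f x := by
    have h3 : Tendsto (fun x : ℝ × ℝ => x.2) (𝓝 ((0 : ℝ), (0 : ℝ))) (𝓝 0) := continuousAt_snd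
    filter_upwards [h3.eventually hqpos] with x hx
    exact ((hSsm x.2 hx).comp x contDiffAt_snd).sub contDiffAt_fst
  have hinv : (fderiv ℝ f (0, 0) ∘L .inr ℝ ℝ ℝ).IsInvertible := by
    refine ⟨ContinuousLinearEquiv.unitsEquivAut ℝ (Units.mk0 _ hsq), ?_⟩
    have h3 : HasFDerivAt (fun y : ℝ => f (0, y)) (fderiv ℝ f (0, 0) ∘L .inr ℝ ℝ ℝ) 0 :=
      (hf.self_of_nhds.differentiableAt (by simp)).hasFDerivAt.comp _ (hasFDerivAt_prodMk_right _ _)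
    refine HasFDerivAt.unique ?_ h3
    have h4 := (hSd.sub_const 0).hasFDerivAt
    have h5 : ContinuousLinearMap.toSpanSingleton ℝ √(q 0) =
        ContinuousLinearEquiv.unitsEquivAut ℝ (Units.mk0 _ hsq) := by
      ext
      simp
    rw [h5] at h4
    exact h4
  obtain ⟨R, hR0, hRs, hRf, hRu⟩ := exists_smooth_implicitFunction hf hinv
  simp only at hR0 hRs hRf
  have hfu : f (0, 0) = 0 := by simp [f, hS0]
  have hSR : ∀ᶠ ρ in 𝓝 (0 : ℝ), S (R ρ) = ρ := by
    filter_upwards [hRf] with ρ hρ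
    rw [hfu] at hρ
    exact sub_eq_zero.1 hρ
  have hSc : ContinuousAt S 0 := hSd.continuousAt
  have hRd := (hRs.self_of_nhds.differentiableAt (by simp)).hasDerivAt
  refine ⟨S, R, hS0, hR0, hSc, hRs, ?_, ?_, hSR, ?_, ?_, deriv R 0, ?_, hRd⟩
  · filter_upwards [hqpos] with r hr
    rw [hgφ, hqg, mul_pow, Real.sq_sqrt hr.le]
    ring
  · have h3 : Tendsto (fun r => (S r, r)) (𝓝 0) (𝓝 (0, 0)) := by
      have : ContinuousAt (fun r => (S r, r)) 0 := hSc.prodMk continuousAt_id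
      simpa only [ContinuousAt, hS0] using this
    filter_upwards [h3.eventually hRu] with r hr
    refine hr ?_
    rw [hfu]
    simp [f]
  · exact fun r hr => mul_nonneg hr (Real.sqrt_nonneg _)
  · exact fun r hr => mul_nonpos_of_nonpos_of_nonneg hr (Real.sqrt_nonneg _)
  · intro h3
    rw [← hR0] at hSd
    have h4 := hSd.comp 0 hRd
    have h5 := h4.unique ((hasDerivAt_id (0 : ℝ)).congr_of_eventuallyEq hSR)
    rw [h3, mul_zero] at h5
    exact zero_ne_one h5

end MorseLemma

section EvenFunctions

open Set Filter Topology
open scoped ContDiff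

/-- A smooth even function of `ρ` is a smooth function of `ρ²`. -/
theorem contDiffOn_comp_sqrt {f : ℝ → ℝ} (hf : ContDiff ℝ ∞ f) (he : ∀ x, f (-x) = f x) :
    ContDiffOn ℝ ∞ (fun x => f (Real.sqrt x)) (Ici 0) := by
  rw [contDiffOn_infty]
  intro n
  induction n generalizing f with
  | zero =>
    exact contDiffOn_zero.2 (hf.continuous.comp Real.continuous_sqrt).continuousOn
  | succ n ih =>
    have hd : ∀ x, HasDerivAt f (deriv f x) x := fun x => (hf.differentiable (by simp) x).hasDerivAt
    have hodd : ∀ x, deriv f (-x) = - deriv f x := by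
      intro x
      have h1 : HasDerivAt (fun x => f (-x)) (deriv f (-x) * -1) x :=
        (hd (-x)).comp x (hasDerivAt_neg x)
      simp only [he] at h1
      have := h1.unique (hd x)
      linarith
    have h00 : deriv f 0 = 0 := by
      have := hodd 0
      rw [neg_zero] at this
      linarith
    obtain ⟨q, hq, hqf⟩ := exists_eq_mul_of_contDiff (contDiff_infty_iff_deriv.1 hf).2 h00
    have hqe : ∀ x, q (-x) = q x := by
      have hcl : ∀ x, x ≠ 0 → q (-x) = q x := by
        intro x hx
        have := hodd x
        rw [hqf, hqf] at this
        have h2 : x * (q (-x) - q x) = 0 := by linarith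
        rcases mul_eq_zero.1 h2 with h | h
        · exact absurd h hx
        · linarith
      intro x
      by_cases hx : x = 0
      · rw [hx, neg_zero]
      · exact hcl x hx
    have hder : ∀ x ∈ Ici (0 : ℝ), HasDerivWithinAt (fun x => f (Real.sqrt x))
        (q (Real.sqrt x) / 2) (Ici 0) x := by
      intro x hx
      have hcont : ContinuousOn (fun x => f (Real.sqrt x)) (Ici 0) :=
        (hf.continuous.comp Real.continuous_sqrt).continuousOn
      have hpos : ∀ x, 0 < x → HasDerivAt (fun x => f (Real.sqrt x)) (q (Real.sqrt x) / 2) x := by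
        intro x hx
        have h1 := (hd (Real.sqrt x)).comp x (Real.hasDerivAt_sqrt hx.ne')
        refine h1.congr_deriv ?_
        have := Real.sqrt_pos.2 hx
        rw [hqf]
        field_simp
      rcases eq_or_lt_of_le (mem_Ici.1 hx) with h | h
      · subst h
        refine hasDerivWithinAt_Ici_of_tendsto_deriv (s := Ioi 0) (a := (0 : ℝ))
          (fun x hx => (hpos x hx).differentiableAt.differentiableWithinAt)
          (hcont.continuousWithinAt self_mem_Ici |>.mono Ioi_subset_Ici_self)
          self_mem_nhdsWithin ?_
        have h2 : Tendsto (fun x => q (Real.sqrt x) / 2) (𝓝[>] 0) (𝓝 (q (Real.sqrt 0) / 2)) :=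
          (((hq.continuous.comp Real.continuous_sqrt).div_const 2).tendsto 0).mono_left
            nhdsWithin_le_nhds
        refine h2.congr' ?_
        filter_upwards [self_mem_nhdsWithin] with x hx using (hpos x hx).deriv.symm
      · exact (hpos x h).hasDerivWithinAt
    have hg := (contDiffOn_succ_iff_derivWithin (n := n) (𝕜 := ℝ)
      (f := fun x => f (Real.sqrt x)) (uniqueDiffOn_Ici 0)).2
      ⟨fun x hx => (hder x hx).differentiableWithinAt, by simp, ((ih hq hqe).div_const 2).congr
        fun x hx => (hder x hx).derivWithin (uniqueDiffOn_Ici 0 x hx)⟩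
    exact_mod_cast hg

/-- Extension of a germ of smooth even function to a global one. -/
theorem exists_even_extension {f : ℝ → ℝ} (hf : ∀ᶠ x in 𝓝 0, ContDiffAt ℝ ∞ f x)
    (he : ∀ᶠ x in 𝓝 0, f (-x) = f x) :
    ∃ g : ℝ → ℝ, ContDiff ℝ ∞ g ∧ (∀ x, g (-x) = g x) ∧ ∀ᶠ x in 𝓝 0, g x = f x := by
  obtain ⟨δ, hδ, hδf⟩ := Metric.eventually_nhds_iff.1 (hf.and he)
  let χ : ContDiffBump (0 : ℝ) := ⟨δ / 3, δ / 2, by positivity, by linarith⟩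
  refine ⟨fun x => χ x * f x, ?_, ?_, ?_⟩
  · rw [contDiff_iff_contDiffAt]
    intro x
    by_cases hx : dist x 0 < δ
    · exact χ.contDiffAt.mul (hδf hx).1
    · refine contDiffAt_const (c := (0 : ℝ)) |>.congr_of_eventuallyEq ?_
      have h1 : ∀ᶠ y in 𝓝 x, δ / 2 < dist y 0 :=
        continuousAt_const.eventually_lt (by fun_prop) (by linarith [not_lt.1 hx])
      filter_upwards [h1] with y hy
      rw [χ.zero_of_le_dist hy.le, zero_mul]
  · intro x
    by_cases hx : dist x 0 < δ
    · simp only [χ.neg, (hδf hx).2]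
    · have h1 : χ x = 0 := χ.zero_of_le_dist (by
        have : χ.rOut = δ / 2 := rfl
        linarith [not_lt.1 hx])
      simp only [χ.neg, h1, zero_mul]
  · filter_upwards [χ.eventuallyEq_one] with x hx
    rw [hx]
    simp

end EvenFunctions

section PeriodLattice

open Set Filter Topology
open scoped ContDiff

variable {E : Type} [NormedAddCommGroup E] [NormedSpace ℝ E]

theorem CommutingPair.action_fixes [FiniteDimensional ℝ E] {B J : E → E} {P : E → ℝ} {Φ Ψ : ℝ → E → E}
    (h : CommutingPair B J P Φ Ψ) {s t a b : ℝ} {x y : E} (hxy : Φ s (Ψ t x) = y) :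
    Φ a (Ψ b x) = x ↔ Φ a (Ψ b y) = y := by
  have h1 : ∀ {s t a b : ℝ} {x y : E}, Φ s (Ψ t x) = y → Φ a (Ψ b x) = x → Φ a (Ψ b y) = y := by
    intro s t a b x y hxy hx
    rw [← hxy, ← h.action_add, add_comm a, add_comm b, h.action_add, hx]
  refine ⟨h1 hxy, h1 (s := -s) (t := -t) ?_⟩
  rw [← hxy, ← h.action_add, neg_add_cancel, neg_add_cancel, h.flow_B.zero, h.flow_J.zero]

namespace EllipticFrame

variable {B J : E → E} {P : E → ℝ} {Φ Ψ : ℝ → E → E} {z₀ : E} {T ν θ : ℝ} {e e₂ : E}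
  {π₁ π₂ πb : E →L[ℝ] ℝ} (h : CommutingPair B J P Φ Ψ)
  (hF : EllipticFrame B J P Φ z₀ T ν θ e e₂ π₁ π₂ πb)

include h hF

/-- The smooth coordinate `S` on the ray with `P = S ^ 2`. -/
theorem exists_ray_coordinate :
    ∃ S R : ℝ → ℝ, S 0 = 0 ∧ R 0 = 0 ∧ ContinuousAt S 0 ∧ (∀ᶠ ρ in 𝓝 0, ContDiffAt ℝ ∞ R ρ) ∧
      (∀ᶠ r in 𝓝 0, P (z₀ + r • e) = S r ^ 2) ∧ (∀ᶠ r in 𝓝 0, R (S r) = r) ∧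
      (∀ᶠ ρ in 𝓝 0, S (R ρ) = ρ) ∧
      (∀ r, 0 ≤ r → 0 ≤ S r) ∧ (∀ r, r ≤ 0 → S r ≤ 0) ∧
      ∃ d, d ≠ 0 ∧ HasDerivAt R d 0 := by
  have hP := h.smooth_P
  have hP' : ContDiff ℝ ∞ (fderiv ℝ P) := hP.fderiv_right (by simp)
  have hl : ∀ r : ℝ, HasDerivAt (fun r : ℝ => z₀ + r • e) e r := fun r => by
    simpa using ((hasDerivAt_id r).smul_const e).const_add z₀
  refine exists_sq_coordinate (φ := fun r => P (z₀ + r • e))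
    (φ' := fun r => fderiv ℝ P (z₀ + r • e) e) (hP.comp (by fun_prop)) (by simp [hF.P_eq_zero])
    (fun r => (hP.differentiable (by simp) _).hasFDerivAt.comp_hasDerivAt r (hl r))
    (by simp [hF.fderiv_P]) ?_ hF.hess_pos
  have h1 : HasFDerivAt (fderiv ℝ P) (fderiv ℝ (fderiv ℝ P) z₀) (z₀ + (0 : ℝ) • e) := by
    simpa using (hP'.differentiable (by simp) z₀).hasFDerivAt
  have h2 : HasDerivAt (fun r : ℝ => fderiv ℝ P (z₀ + r • e)) (fderiv ℝ (fderiv ℝ P) z₀ e) 0 :=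
    HasFDerivAt.comp_hasDerivAt (l := fderiv ℝ P) 0 h1 (hl 0)
  exact (ContinuousLinearMap.apply ℝ ℝ e).hasFDerivAt.comp_hasDerivAt 0 h2

variable [FiniteDimensional ℝ E]

/-- Every point close to `z₀` is moved by the joint action to the positive half of the ray
`z₀ + ℝ e`. -/
theorem eventually_meets_ray {r₁ : ℝ} (hr₁ : 0 < r₁) :
    ∀ᶠ z in 𝓝 z₀, ∃ s t r, 0 ≤ r ∧ r < r₁ ∧ Φ s (Ψ t z) = z₀ + r • e := by
  obtain ⟨c1, c2, c3, c4, c5, c6, c7, c8, c9⟩ := hF.coords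
  have hcirc : ∀ φ ∈ Icc (-Real.pi) Real.pi, ∀ᶠ q : ℝ × ℝ in 𝓝 ((0 : ℝ), φ), 0 ≤ q.1 →
      ∃ s t r, 0 ≤ r ∧ r < r₁ ∧
        Φ s (Ψ t (z₀ + q.1 • (Real.cos q.2 • e + Real.sin q.2 • e₂))) = z₀ + r • e := by
    intro φ _
    have hφ : -(ν * (-(φ / ν))) = φ := by
      have := hF.ν_pos.ne'
      field_simp
    obtain ⟨w, k, hw0, hk0, -, hkc, hwk, -⟩ := hF.exists_blowup h (-(φ / ν)) rfl
    rw [hφ] at hk0 hkc hwk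
    set c : ℝ × ℝ → E × ℝ := fun q => (Real.cos q.2 • e + Real.sin q.2 • e₂, q.1) with hc
    have hct : Tendsto c (𝓝 (0, φ)) (𝓝 (Real.cos φ • e + Real.sin φ • e₂, 0)) := by
      have : Continuous c := by fun_prop
      exact this.tendsto (0, φ)
    have h1 : ∀ᶠ q in 𝓝 (Real.cos φ • e + Real.sin φ • e₂, (0 : ℝ)), 0 < k q :=
      continuousAt_const.eventually_lt hkc (by rw [hk0]; exact zero_lt_one)
    have h2 : ∀ᶠ q in 𝓝 (Real.cos φ • e + Real.sin φ • e₂, (0 : ℝ)), q.2 * k q < r₁ :=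
      (continuousAt_snd.mul hkc).eventually_lt continuousAt_const (by simpa using hr₁)
    filter_upwards [hct.eventually h1, hct.eventually h2, hct.eventually hwk] with q hq1 hq2 hq3 hq0
    exact ⟨_, _, _, mul_nonneg hq0 hq1.le, hq2, hq3⟩
  have hcirc' := isCompact_Icc.eventually_forall_of_forall_eventually
    (P := fun ρ φ => 0 ≤ ρ → ∃ s t r, 0 ≤ r ∧ r < r₁ ∧
      Φ s (Ψ t (z₀ + ρ • (Real.cos φ • e + Real.sin φ • e₂))) = z₀ + r • e) hcirc
  let g : E × ℝ → ℝ := fun q => πb (Φ q.2 q.1 - z₀)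
  have hg : ContDiff ℝ ∞ g := πb.contDiff.comp
    ((h.contDiff_flow.comp (contDiff_snd.prodMk contDiff_fst)).sub contDiff_const)
  have hinv : (fderiv ℝ g (z₀, 0) ∘L .inr ℝ E ℝ).IsInvertible := by
    refine ⟨ContinuousLinearEquiv.refl ℝ ℝ, ?_⟩
    have h1 : HasFDerivAt (fun s : ℝ => g (z₀, s)) (fderiv ℝ g (z₀, 0) ∘L .inr ℝ E ℝ) 0 :=
      (hg.differentiable (by simp) _).hasFDerivAt.comp _ (hasFDerivAt_prodMk_right _ _)
    have h2 : HasDerivAt (fun s : ℝ => g (z₀, s)) (πb (B z₀)) 0 := by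
      have h3 := (h.flow_B.deriv 0 z₀).sub_const z₀
      rw [h.flow_B.zero] at h3
      exact πb.hasFDerivAt.comp_hasDerivAt 0 h3
    have h4 := h1.hasDerivAt.unique h2
    ext
    rw [h4, c9]
    rfl
  obtain ⟨ψ, hψ0, hψs, hψg, -⟩ := exists_smooth_implicitFunction
    (Eventually.of_forall fun v => hg.contDiffAt) hinv
  simp only at hψ0 hψs hψg
  have hg0 : g (z₀, 0) = 0 := by simp [g, h.flow_B.zero]
  let y : E → E := fun z => Φ (ψ z) z - z₀
  have hyc : ContinuousAt y z₀ :=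
    (h.contDiff_flow.continuous.continuousAt.comp
      (hψs.self_of_nhds.continuousAt.prodMk continuousAt_id)).sub continuousAt_const
  have hy0 : y z₀ = 0 := by simp [y, hψ0, h.flow_B.zero]
  let ζ : E → ℂ := fun z => (π₁ (y z) : ℂ) + (π₂ (y z) : ℂ) * Complex.I
  have hζc : ContinuousAt (fun z => ‖ζ z‖) z₀ := by
    have h1 : ContinuousAt (fun z => π₁ (y z)) z₀ := π₁.continuous.continuousAt.comp hyc
    have h2 : ContinuousAt (fun z => π₂ (y z)) z₀ := π₂.continuous.continuousAt.comp hyc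
    exact ((Complex.continuous_ofReal.continuousAt.comp h1).add
      ((Complex.continuous_ofReal.continuousAt.comp h2).mul continuousAt_const)).norm
  have hζ0 : Tendsto (fun z => ‖ζ z‖) (𝓝 z₀) (𝓝 0) := by
    have : ‖ζ z₀‖ = 0 := by simp [ζ, hy0]
    rw [← this]
    exact hζc
  filter_upwards [hζ0.eventually hcirc', hψg] with z hz hzg
  rw [hg0] at hzg
  obtain ⟨s, t, r, hr0, hr1, hr⟩ := hz (Complex.arg (ζ z)) (Ioc_subset_Icc_self
    (Complex.arg_mem_Ioc _)) (norm_nonneg _)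
  refine ⟨s + ψ z, t + 0, r, hr0, hr1, ?_⟩
  rw [h.action_add, h.flow_J.zero, ← hr]
  congr 2
  have h1 := hF.decomp (y z)
  have h2 : πb (y z) = 0 := hzg
  have h3 : ‖ζ z‖ * Real.cos (Complex.arg (ζ z)) = π₁ (y z) := by
    rw [Complex.norm_mul_cos_arg]
    simp [ζ]
  have h4 : ‖ζ z‖ * Real.sin (Complex.arg (ζ z)) = π₂ (y z) := by
    rw [Complex.norm_mul_sin_arg]
    simp [ζ]
  rw [smul_add, smul_smul, smul_smul, h3, h4]
  rw [h2, zero_smul, add_zero] at h1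
  rw [← h1]
  simp [y]

/-- Along the whole periodic orbit, nearby points are moved to the positive half of the ray. -/
theorem exists_meets_ray (hbasis : ∀ O : Set E, IsOpen O → (∀ t, Φ t z₀ ∈ O) →
      ∃ ε > 0, ∀ z, P z < ε → z ∈ O) {r₁ : ℝ} (hr₁ : 0 < r₁) :
    ∃ ε > 0, ∀ z, P z < ε → ∃ s t r, 0 ≤ r ∧ r < r₁ ∧ Φ s (Ψ t z) = z₀ + r • e := by
  let G : Set E := {z | ∃ s t r, 0 ≤ r ∧ r < r₁ ∧ Φ s (Ψ t z) = z₀ + r • e}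
  obtain ⟨ε, hε, hεz⟩ := hbasis (interior G) isOpen_interior (fun a => by
      rw [mem_interior_iff_mem_nhds]
      have h1 : Tendsto (Φ (-a)) (𝓝 (Φ a z₀)) (𝓝 z₀) := by
        have := (h.differentiable_flow (-a)).continuous.tendsto (Φ a z₀)
        rwa [← h.flow_add, neg_add_cancel, h.flow_B.zero] at this
      filter_upwards [h1.eventually (hF.eventually_meets_ray h hr₁)] with z hz
      obtain ⟨s, t, r, hr0, hr1, hr⟩ := hz
      refine ⟨s + -a, t + 0, r, hr0, hr1, ?_⟩
      rw [h.action_add, h.flow_J.zero, hr])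
  exact ⟨ε, hε, fun z hz => interior_subset (s := G) (hεz z hz)⟩

/-- The first return of the section to itself under the flow of `B`. -/
theorem exists_return_map : ∃ v : ℝ → E, ContDiff ℝ ∞ v ∧
    v 0 = Real.cos θ • e + Real.sin θ • e₂ ∧ ∀ r, Φ T (z₀ + r • e) = z₀ + r • v r := by
  have hs : ContDiff ℝ ∞ (fun x : ℝ × ℝ => Φ T (z₀ + x.2 • e) - z₀) := by
    have : ContDiff ℝ ∞ (fun x : ℝ × ℝ => (T, z₀ + x.2 • e)) := by fun_prop
    exact (h.contDiff_flow.comp this).sub contDiff_const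
  obtain ⟨G, hG, hG1, hG0⟩ := exists_eq_smul_of_contDiff hs (fun _ => by simp [hF.periodic])
  refine ⟨fun r => G (0, r), hG.comp (by fun_prop), ?_, fun r => ?_⟩
  · simp only [hG0]
    rw [← hF.monodromy]
    have h1 : HasDerivAt (fun r : ℝ => ((0 : ℝ), r)) (0, 1) 0 :=
      (hasDerivAt_const _ _).prodMk (hasDerivAt_id _)
    have h2 : HasDerivAt (fun r : ℝ => Φ T (z₀ + r • e) - z₀)
        (fderiv ℝ (fun x : ℝ × ℝ => Φ T (z₀ + x.2 • e) - z₀) (0, 0) (0, 1)) 0 :=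
      HasFDerivAt.comp_hasDerivAt (l := fun x : ℝ × ℝ => Φ T (z₀ + x.2 • e) - z₀) 0
        (hs.differentiable (by simp) _).hasFDerivAt h1
    refine h2.unique ?_
    have h3 : HasDerivAt (fun r : ℝ => z₀ + r • e) e 0 := by
      simpa using ((hasDerivAt_id (0 : ℝ)).smul_const e).const_add z₀
    refine HasDerivAt.sub_const z₀ (HasFDerivAt.comp_hasDerivAt (l := Φ T) 0 ?_ h3)
    simpa using (h.differentiable_flow T (z₀ + (0 : ℝ) • e)).hasFDerivAt
  · have := hG1 0 r
    simp only at this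
    rw [← this]
    abel

end EllipticFrame

end PeriodLattice

section PeriodFunctions

open Set Filter Topology
open scoped ContDiff

variable {E : Type} [NormedAddCommGroup E] [NormedSpace ℝ E] [FiniteDimensional ℝ E]

namespace EllipticFrame

variable {B J : E → E} {P : E → ℝ} {Φ Ψ : ℝ → E → E} {z₀ : E} {T ν θ : ℝ} {e e₂ : E}
  {π₁ π₂ πb : E →L[ℝ] ℝ} (h : CommutingPair B J P Φ Ψ)
  (hF : EllipticFrame B J P Φ z₀ T ν θ e e₂ π₁ π₂ πb)

include h hF

/-- Smooth families of periods along the ray, locally unique off the axis. -/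
theorem exists_return_times : ∃ s t : ℝ → ℝ, s 0 = 0 ∧ t 0 = -(θ / ν) ∧
    (∀ᶠ r in 𝓝 0, ContDiffAt ℝ ∞ s r) ∧ (∀ᶠ r in 𝓝 0, ContDiffAt ℝ ∞ t r) ∧
    (∀ᶠ r in 𝓝 0, Φ (T + r * s r) (Ψ (t r) (z₀ + r • e)) = z₀ + r • e) ∧
    ∀ᶠ x : ℝ × ℝ × ℝ in 𝓝 (0, (0, -(θ / ν))), x.1 ≠ 0 →
      Φ (T + x.1 * x.2.1) (Ψ x.2.2 (z₀ + x.1 • e)) = z₀ + x.1 • e →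
        s x.1 = x.2.1 ∧ t x.1 = x.2.2 := by
  obtain ⟨v, hv, hv0, hvT⟩ := hF.exists_return_map h
  obtain ⟨S, R, -, -, -, -, hPS, hRS, -, hS0, hS1, -⟩ := hF.exists_ray_coordinate h
  have hθ : -(ν * (-(θ / ν))) = θ := by
    have := hF.ν_pos.ne'
    field_simp
  obtain ⟨w, k, hw0, hk0, hws, hkc, hwk, huniq⟩ := hF.exists_blowup h (-(θ / ν)) (v₀ := v 0)
    (by rw [hθ, hv0])
  have hshift : ∀ r s t, Φ (T + r * s) (Ψ t (z₀ + r • e)) =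
      Φ (r * s) (Ψ t (z₀ + r • v r)) := by
    intro r s t
    rw [add_comm T]
    conv_lhs => rw [← add_zero t]
    rw [h.action_add, h.flow_J.zero, hvT]
  have hc : ContDiff ℝ ∞ (fun r => (v r, r)) := hv.prodMk contDiff_id
  have hct : Tendsto (fun r => (v r, r)) (𝓝 0) (𝓝 (v 0, 0)) := hc.continuous.tendsto 0
  have hsm : ∀ᶠ r in 𝓝 0, ContDiffAt ℝ ∞ (fun r => w (v r, r)) r := by
    filter_upwards [hct.eventually hws] with r hr
    exact ContDiffAt.comp (f := fun r => (v r, r)) r hr hc.contDiffAt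
  refine ⟨fun r => (w (v r, r)).1, fun r => (w (v r, r)).2, by simp [hw0], by simp [hw0],
    hsm.mono fun r hr => contDiff_fst.contDiffAt.comp r hr,
    hsm.mono fun r hr => contDiff_snd.contDiffAt.comp r hr, ?_, ?_⟩
  · have hk1 : ∀ᶠ r in 𝓝 0, 0 < k (v r, r) :=
      hct.eventually (continuousAt_const.eventually_lt hkc (by rw [hk0]; exact zero_lt_one))
    have hk2 : Tendsto (fun r => r * k (v r, r)) (𝓝 0) (𝓝 0) := by
      have := (continuous_id.tendsto (0 : ℝ)).mul (hkc.tendsto.comp hct)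
      simpa using this
    filter_upwards [hk1, hct.eventually hwk, hPS, hRS, hk2.eventually hPS, hk2.eventually hRS]
      with r h1 h2 h3 h4 h5 h6
    rw [hshift]
    rw [h2]
    have h7 : P (z₀ + (r * k (v r, r)) • e) = P (z₀ + r • e) := by
      rw [← h2, h.apply_action, ← hvT]
      exact h.apply_flow _ _
    rw [h3, h5] at h7
    have h8 : S (r * k (v r, r)) = S r := by
      rcases le_total 0 r with hr | hr
      · exact (sq_eq_sq₀ (hS0 _ (mul_nonneg hr h1.le)) (hS0 _ hr)).1 h7
      · have a1 := hS1 _ hr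
        have a2 := hS1 _ (mul_nonpos_of_nonpos_of_nonneg hr h1.le)
        rcases sq_eq_sq_iff_eq_or_eq_neg.1 h7 with h | h
        · exact h
        · linarith
    rw [← h6, h8, h4]
  · have hct' : Tendsto (fun x : ℝ × ℝ × ℝ => ((v x.1, x.1), x.2)) (𝓝 (0, (0, -(θ / ν))))
        (𝓝 ((v 0, 0), (0, -(θ / ν)))) := by
      have : Continuous (fun x : ℝ × ℝ × ℝ => ((v x.1, x.1), x.2)) :=
        ((hv.continuous.comp continuous_fst).prodMk continuous_fst).prodMk continuous_snd
      exact this.tendsto _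
    filter_upwards [hct'.eventually huniq] with x hx hx0 hfix
    rw [hshift] at hfix
    have := hx hx0 x.1 hfix
    exact ⟨congrArg Prod.fst this, congrArg Prod.snd this⟩

/-- The periods of the joint action are smooth even functions of the square root of `P`. -/
theorem exists_period_functions (hbasis : ∀ O : Set E, IsOpen O → (∀ t, Φ t z₀ ∈ O) →
      ∃ ε > 0, ∀ z, P z < ε → z ∈ O) :
    ∃ f₁ f₂ : ℝ → ℝ, ContDiff ℝ ∞ f₁ ∧ ContDiff ℝ ∞ f₂ ∧ (∀ x, f₁ (-x) = f₁ x) ∧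
      (∀ x, f₂ (-x) = f₂ x) ∧ f₁ 0 = T ∧
      ∃ ε > 0, ∀ z, P z < ε → Φ (f₁ √(P z)) (Ψ (f₂ √(P z)) z) = z := by
  obtain ⟨s, t, hs0, ht0, hs, ht, hfix, huniq⟩ := hF.exists_return_times h
  obtain ⟨S, R, hS0, hR0, hSc, hR, hPS, hRS, hSR, hSpos, hSneg, d, hd, hRd⟩ :=
    hF.exists_ray_coordinate h
  have hRt : Tendsto R (𝓝 0) (𝓝 0) := by
    have := hRd.continuousAt.tendsto
    rwa [hR0] at this
  have hneg : Tendsto (fun ρ : ℝ => -ρ) (𝓝 0) (𝓝 0) := by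
    simpa using (continuous_neg.tendsto (0 : ℝ))
  have hSt : Tendsto S (𝓝 0) (𝓝 0) := by
    have := hSc.tendsto
    rwa [hS0] at this
  obtain ⟨r₁, hr₁, hr₁S⟩ := Metric.eventually_nhds_iff.1 (hPS.and hRS)
  have hxt : Tendsto (fun r : ℝ => z₀ + r • e) (𝓝 0) (𝓝 z₀) := by
    have : Continuous (fun r : ℝ => z₀ + r • e) := by fun_prop
    simpa using this.tendsto 0
  have hmeet : ∀ᶠ ρ in 𝓝 0, ∃ a b, Φ a (Ψ b (z₀ + R ρ • e)) = z₀ + R |ρ| • e := by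
    filter_upwards [hRt.eventually (hxt.eventually (hF.eventually_meets_ray h hr₁)),
      hRt.eventually hPS, hSR] with ρ h1 h2 h3
    obtain ⟨a, b, r, hr0, hr1, hab⟩ := h1
    refine ⟨a, b, ?_⟩
    obtain ⟨h4, h5⟩ := hr₁S (y := r) (by rw [Real.dist_0_eq_abs, abs_of_nonneg hr0]; exact hr1)
    rw [← hab, h.apply_action, h2, h3] at h4
    have h6 : |ρ| = S r := by
      rw [← abs_of_nonneg (hSpos r hr0)]
      exact (sq_eq_sq_iff_abs_eq_abs _ _).1 h4
    rw [hab, h6, h5]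
  have hfixneg : ∀ᶠ ρ in 𝓝 0, Φ (T + R ρ * s (R ρ)) (Ψ (t (R ρ)) (z₀ + R (-ρ) • e)) =
      z₀ + R (-ρ) • e := by
    filter_upwards [hmeet, hneg.eventually hmeet, hRt.eventually hfix] with ρ h1 h2 h3
    obtain ⟨a, b, hab⟩ := h1
    obtain ⟨a', b', hab'⟩ := h2
    rw [abs_neg] at hab'
    rw [h.action_fixes hab', ← h.action_fixes hab]
    exact h3
  have hst : ContinuousAt s 0 := hs.self_of_nhds.continuousAt
  have htt : ContinuousAt t 0 := ht.self_of_nhds.continuousAt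
  have hsR : Tendsto (fun ρ => s (R ρ)) (𝓝 0) (𝓝 0) := by
    have := hst.tendsto.comp hRt
    rwa [hs0] at this
  have htR : Tendsto (fun ρ => t (R ρ)) (𝓝 0) (𝓝 (-(θ / ν))) := by
    have := htt.tendsto.comp hRt
    rwa [ht0] at this
  have hratio : Tendsto (fun ρ => R ρ / R (-ρ)) (𝓝[≠] 0) (𝓝 (d / -d)) := by
    have hRd' : HasDerivAt (fun ρ => R (-ρ)) (-d) 0 := by
      have h1 : HasDerivAt R d (-0) := by rwa [neg_zero]
      exact (h1.comp (0 : ℝ) (hasDerivAt_neg (0 : ℝ))).congr_deriv (by ring)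
    refine Tendsto.congr' ?_ (hRd.tendsto_slope_zero.div hRd'.tendsto_slope_zero (by simpa using hd))
    filter_upwards [self_mem_nhdsWithin] with ρ hρ
    have hρ' : ρ ≠ 0 := hρ
    simp only [zero_add, hR0, neg_zero, sub_zero, smul_eq_mul]
    exact mul_div_mul_left _ _ (inv_ne_zero hρ')
  have heven : ∀ᶠ ρ in 𝓝 0, T + R (-ρ) * s (R (-ρ)) = T + R ρ * s (R ρ) ∧
      t (R (-ρ)) = t (R ρ) := by
    have hlim : Tendsto (fun ρ => (R (-ρ), (R ρ / R (-ρ) * s (R ρ), t (R ρ)))) (𝓝[≠] 0)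
        (𝓝 (0, (0, -(θ / ν)))) := by
      refine ((hRt.comp hneg).mono_left nhdsWithin_le_nhds).prodMk_nhds
        (Tendsto.prodMk_nhds ?_ (htR.mono_left nhdsWithin_le_nhds))
      simpa using hratio.mul (hsR.mono_left nhdsWithin_le_nhds)
    have h1 : ∀ᶠ ρ in 𝓝[≠] 0, T + R (-ρ) * s (R (-ρ)) = T + R ρ * s (R ρ) ∧
        t (R (-ρ)) = t (R ρ) := by
      filter_upwards [hlim.eventually huniq, nhdsWithin_le_nhds hfixneg,
        nhdsWithin_le_nhds (hneg.eventually hSR), self_mem_nhdsWithin] with ρ h1 h2 h3 hρ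
      have hρ' : ρ ≠ 0 := hρ
      have h4 : R (-ρ) ≠ 0 := by
        intro h0
        rw [h0, hS0] at h3
        exact hρ' (by linarith)
      have h5 : R (-ρ) * (R ρ / R (-ρ) * s (R ρ)) = R ρ * s (R ρ) := by
        field_simp
      obtain ⟨h6, h7⟩ := h1 h4 (by simp only [h5]; exact h2)
      exact ⟨by rw [h6, h5], h7⟩
    rw [eventually_nhdsWithin_iff] at h1
    filter_upwards [h1] with ρ hρ
    by_cases h0 : ρ = 0
    · simp [h0]
    · exact hρ h0
  have hsm : ∀ᶠ ρ in 𝓝 0, ContDiffAt ℝ ∞ (fun ρ => T + R ρ * s (R ρ)) ρ := by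
    filter_upwards [hR, hRt.eventually hs] with ρ h1 h2
    exact contDiffAt_const.add (h1.mul (h2.comp ρ h1))
  have htm : ∀ᶠ ρ in 𝓝 0, ContDiffAt ℝ ∞ (fun ρ => t (R ρ)) ρ := by
    filter_upwards [hR, hRt.eventually ht] with ρ h1 h2
    exact h2.comp ρ h1
  obtain ⟨f₁, hf₁, hf₁e, hf₁g⟩ := exists_even_extension hsm (heven.mono fun _ => And.left)
  obtain ⟨f₂, hf₂, hf₂e, hf₂g⟩ := exists_even_extension htm (heven.mono fun _ => And.right)
  refine ⟨f₁, f₂, hf₁, hf₂, hf₁e, hf₂e, ?_, ?_⟩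
  · rw [hf₁g.self_of_nhds, hR0, zero_mul, add_zero]
  obtain ⟨r₂, hr₂, hr₂S⟩ := Metric.eventually_nhds_iff.1
    (((hPS.and hRS).and hfix).and (hSt.eventually (hf₁g.and hf₂g)))
  obtain ⟨ε, hε, hz⟩ := hF.exists_meets_ray h hbasis hr₂
  refine ⟨ε, hε, fun z hzε => ?_⟩
  obtain ⟨a, b, r, hr0, hr1, hab⟩ := hz z hzε
  obtain ⟨⟨⟨h1, h2⟩, h3⟩, h4, h5⟩ :=
    hr₂S (y := r) (by rw [Real.dist_0_eq_abs, abs_of_nonneg hr0]; exact hr1)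
  have h6 : √(P z) = S r := by
    rw [← Real.sqrt_sq (hSpos r hr0), ← h1, ← hab, h.apply_action]
  rw [h.action_fixes hab, h6, h4, h5, h2]
  exact h3

end EllipticFrame

end PeriodFunctions

section RotationBasis

open Set Filter Topology Module
open scoped ContDiff

variable {E : Type} [NormedAddCommGroup E] [NormedSpace ℝ E]

theorem exists_dual_coordinates (hdim : finrank ℝ E = 3) {Q : E →L[ℝ] E →L[ℝ] ℝ} {e e₂ b : E}
    (hb : b ≠ 0) (hQb : ∀ v, Q v b = 0) (hee : Q e e ≠ 0) (hff : Q e₂ e₂ ≠ 0)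
    (hef : Q e e₂ = 0) (hfe : Q e₂ e = 0) :
    ∃ π₁ π₂ πb : E →L[ℝ] ℝ, (∀ v, v = π₁ v • e + π₂ v • e₂ + πb v • b) ∧
      π₁ e = 1 ∧ π₂ e = 0 ∧ πb e = 0 ∧ π₁ e₂ = 0 ∧ π₂ e₂ = 1 ∧ πb e₂ = 0 ∧
      π₁ b = 0 ∧ π₂ b = 0 ∧ πb b = 1 := by
  have : FiniteDimensional ℝ E := .of_finrank_pos (by omega)
  have hli : LinearIndependent ℝ ![e, e₂, b] := by
    rw [Fintype.linearIndependent_iff]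
    intro g hg
    simp only [Fin.sum_univ_three, Matrix.cons_val_zero, Matrix.cons_val_one,
      Matrix.cons_val_two, Matrix.tail_cons, Matrix.head_cons] at hg
    have h0 : g 0 = 0 := by
      have := congrArg (Q e) hg
      simpa [hQb, hef, hee] using this
    have h1 : g 1 = 0 := by
      have := congrArg (Q e₂) hg
      simpa [hQb, hfe, hff] using this
    have h2 : g 2 = 0 := by
      simpa [h0, h1, hb] using hg
    intro i
    fin_cases i <;> assumption
  let 𝓑 := basisOfLinearIndependentOfCardEqFinrank hli (by simp [hdim])
  have h0 : 𝓑 0 = e := by simp [𝓑]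
  have h1 : 𝓑 1 = e₂ := by simp [𝓑]
  have h2 : 𝓑 2 = b := by simp [𝓑]
  refine ⟨(𝓑.coord 0).toContinuousLinearMap, (𝓑.coord 1).toContinuousLinearMap,
    (𝓑.coord 2).toContinuousLinearMap, fun v => ?_, ?_⟩
  · have := 𝓑.sum_repr v
    rw [Fin.sum_univ_three, h0, h1, h2] at this
    exact this.symm
  · simp only [LinearMap.coe_toContinuousLinearMap', Basis.coord_apply]
    rw [← h0, ← h1, ← h2]
    simp

theorem exists_rotation_basis (hdim : finrank ℝ E = 3) {Q : E →L[ℝ] E →L[ℝ] ℝ} {L M : E →L[ℝ] E}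
    {b : E} (hb : b ≠ 0) (hsymm : ∀ v w, Q v w = Q w v) (hQb : ∀ v, Q v b = 0)
    (hQ : ∀ v, (∀ c : ℝ, v ≠ c • b) → 0 < Q v v) (hskew : ∀ v w, Q (L v) w = -Q v (L w))
    (hLb : L b = 0) (hL : ∀ v, (∀ c : ℝ, v ≠ c • b) → ∀ c : ℝ, L v ≠ c • b)
    (hM : ∀ v, Q (M v) (M v) = Q v v) (hML : ∀ v, M (L v) = L (M v)) :
    ∃ (ν θ : ℝ) (e e₂ : E) (π₁ π₂ πb : E →L[ℝ] ℝ),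
      (∀ v, v = π₁ v • e + π₂ v • e₂ + πb v • b) ∧
      (π₁ e = 1 ∧ π₂ e = 0 ∧ πb e = 0 ∧ π₁ e₂ = 0 ∧ π₂ e₂ = 1 ∧ πb e₂ = 0 ∧
      π₁ b = 0 ∧ π₂ b = 0 ∧ πb b = 1) ∧ 0 < ν ∧ L e = ν • e₂ ∧ L e₂ = -(ν • e) ∧
      M e = Real.cos θ • e + Real.sin θ • e₂ ∧ 0 < Q e e := by
  have hQL : ∀ v, Q v (L v) = 0 := fun v => by
    have h1 := hskew v v
    rw [hsymm] at h1
    linarith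
  have hQL' : ∀ v, Q (L v) v = 0 := fun v => by rw [hsymm, hQL]
  obtain ⟨u, hu⟩ : ∃ u : E, ∀ c : ℝ, u ≠ c • b := by
    by_contra! hcon
    have : finrank ℝ E ≤ 1 := finrank_le_one b fun w => by
      obtain ⟨c, hc⟩ := hcon w
      exact ⟨c, hc.symm⟩
    omega
  have hu1 := hL u hu
  have hu2 := hL _ hu1
  have hu3 := hL _ hu2
  obtain ⟨e₀, he₀⟩ : ∃ e₀, e₀ = L u := ⟨_, rfl⟩
  rw [← he₀] at hu1 hu2 hu3
  have hq0 := hQ _ hu1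
  have hq1 := hQ _ hu2
  obtain ⟨κ, z, hκ, hκz⟩ : ∃ κ z : ℝ, 0 < κ ∧ L (L e₀) = -(κ • e₀) + z • b := by
    obtain ⟨π₁, π₂, πb, hd, -⟩ := exists_dual_coordinates hdim hb hQb hq0.ne' hq1.ne' (hQL e₀)
      (hQL' e₀)
    have h1 := hd (L (L e₀))
    have h2 : π₂ (L (L e₀)) = 0 := by
      have := congrArg (Q (L e₀)) h1
      simpa [hQb, hQL, hQL', hq1.ne'] using this
    have h3 : -Q (L e₀) (L e₀) = π₁ (L (L e₀)) * Q e₀ e₀ := by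
      have := congrArg (Q e₀) h1
      rw [← hskew] 
      rw [h2] at this
      rw [hsymm, this]
      simp [hQb]
    refine ⟨-π₁ (L (L e₀)), πb (L (L e₀)), ?_, ?_⟩
    · by_contra! hcon
      have : 0 ≤ π₁ (L (L e₀)) * Q e₀ e₀ := mul_nonneg (by linarith) hq0.le
      linarith
    · conv_lhs => rw [h1, h2]
      simp
  obtain ⟨e, he⟩ : ∃ e, e = L e₀ := ⟨_, rfl⟩
  have hLLe : L (L e) = -(κ • e) := by
    rw [he, hκz]
    simp [hLb]
  rw [← he] at hq1
  have hν : 0 < √κ := Real.sqrt_pos.2 hκ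
  have hνν : √κ * √κ = κ := Real.mul_self_sqrt hκ.le
  obtain ⟨e₂, he₂⟩ : ∃ e₂, e₂ = (√κ)⁻¹ • L e := ⟨_, rfl⟩
  have hLe : L e = √κ • e₂ := by rw [he₂, smul_smul, mul_inv_cancel₀ hν.ne', one_smul]
  have hLe₂ : L e₂ = -(√κ • e) := by
    rw [he₂, map_smul, hLLe, smul_neg, smul_smul]
    congr 2
    field_simp
    linarith
  have hee₂ : Q e e₂ = 0 := by simp [he₂, hQL]
  have he₂e : Q e₂ e = 0 := by rw [hsymm, hee₂]
  have he₂e₂ : Q e₂ e₂ = Q e e := by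
    have h1 := hskew e e₂
    rw [hLe, hLe₂] at h1
    simp only [map_smul, smul_apply, smul_eq_mul, map_neg, neg_neg] at h1
    exact mul_left_cancel₀ hν.ne' h1
  obtain ⟨π₁, π₂, πb, hd, hco⟩ := exists_dual_coordinates hdim hb hQb hq1.ne'
    (he₂e₂ ▸ hq1.ne') hee₂ he₂e
  obtain ⟨α, β, hαβ⟩ : ∃ α β : ℝ, M e = α • e + β • e₂ := by
    have h1 : M e = L (M e₀) := by rw [he, hML]
    have h2 := hd (M e₀)
    rw [h2] at h1
    refine ⟨-(π₂ (M e₀) * √κ), π₁ (M e₀) * √κ, ?_⟩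
    rw [h1]
    simp only [map_add, map_smul, hLe, hLe₂, hLb, smul_zero, add_zero, smul_neg, smul_smul, neg_smul]
    abel
  have hone : α ^ 2 + β ^ 2 = 1 := by
    have h1 := hM e
    rw [hαβ] at h1
    simp only [map_add, map_smul, add_apply, smul_apply,
      smul_eq_mul, hee₂, he₂e, he₂e₂, mul_zero, zero_add, add_zero] at h1
    exact mul_right_cancel₀ hq1.ne' (by linear_combination h1)
  let ζ : ℂ := ⟨α, β⟩
  have hζ : ‖ζ‖ = 1 := by
    rw [Complex.norm_def, Complex.normSq_apply, Real.sqrt_eq_one]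
    simp only [ζ]
    linarith
  refine ⟨√κ, Complex.arg ζ, e, e₂, π₁, π₂, πb, hd, hco, hν, hLe, hLe₂, ?_, hq1⟩
  have h1 := Complex.norm_mul_cos_arg ζ
  have h2 := Complex.norm_mul_sin_arg ζ
  rw [hζ, one_mul] at h1 h2
  rw [h1, h2, hαβ]

variable [FiniteDimensional ℝ E]

/-- At an elliptic zero of `J` on a periodic orbit of `B` the linearised data form a rotation
frame. -/
theorem CommutingPair.exists_ellipticFrame {B J : E → E} {P : E → ℝ} {Φ Ψ : ℝ → E → E}
    (h : CommutingPair B J P Φ Ψ) (hdim : finrank ℝ E = 3) {z₀ : E} {T : ℝ} (hT : 0 < T)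
    (hper : Φ T z₀ = z₀) (hB : B z₀ ≠ 0) (hJ : J z₀ = 0) (hP : P z₀ = 0) (hP0 : ∀ z, 0 ≤ P z)
    (hQb : ∀ v, fderiv ℝ (fderiv ℝ P) z₀ v (B z₀) = 0)
    (hQ : ∀ v, (∀ c : ℝ, v ≠ c • B z₀) → 0 < fderiv ℝ (fderiv ℝ P) z₀ v v)
    (hskew : ∀ v w, fderiv ℝ (fderiv ℝ P) z₀ v (fderiv ℝ J z₀ w) =
      -fderiv ℝ (fderiv ℝ P) z₀ w (fderiv ℝ J z₀ v))
    (hker : ∀ v, (∀ c : ℝ, v ≠ c • B z₀) → ∀ c : ℝ, fderiv ℝ J z₀ v ≠ c • B z₀) :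
    ∃ (ν θ : ℝ) (e e₂ : E) (π₁ π₂ πb : E →L[ℝ] ℝ),
      EllipticFrame B J P Φ z₀ T ν θ e e₂ π₁ π₂ πb := by
  have hP1 : ContDiff ℝ ∞ (fderiv ℝ P) := h.smooth_P.fderiv_right (by simp)
  have hsymm : ∀ v w, fderiv ℝ (fderiv ℝ P) z₀ v w = fderiv ℝ (fderiv ℝ P) z₀ w v :=
    second_derivative_symmetric (fun y => (h.smooth_P.differentiable (by simp) y).hasFDerivAt)
      (hP1.differentiable (by simp) z₀).hasFDerivAt
  have hdP : fderiv ℝ P z₀ = 0 :=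
    IsLocalMin.fderiv_eq_zero (Eventually.of_forall fun z => by rw [hP]; exact hP0 z)
  have hΦ : ContDiff ℝ ∞ (Φ T) := h.contDiff_flow.comp (contDiff_const.prodMk contDiff_id)
  have hΦ1 : ContDiff ℝ ∞ (fderiv ℝ (Φ T)) := hΦ.fderiv_right (by simp)
  have hl : ∀ v : E, HasDerivAt (fun r : ℝ => z₀ + r • v) v 0 := fun v => by
    simpa using ((hasDerivAt_id (0 : ℝ)).smul_const v).const_add z₀
  have hcomp : ∀ {F : Type} [NormedAddCommGroup F] [NormedSpace ℝ F] (g : E → F) (v : E),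
      Differentiable ℝ g → HasDerivAt (fun r : ℝ => g (z₀ + r • v)) (fderiv ℝ g z₀ v) 0 := by
    intro F _ _ g v hg
    refine HasFDerivAt.comp_hasDerivAt (l := g) 0 ?_ (hl v)
    simpa using (hg (z₀ + (0 : ℝ) • v)).hasFDerivAt
  have hM : ∀ v, fderiv ℝ (fderiv ℝ P) z₀ (fderiv ℝ (Φ T) z₀ v) (fderiv ℝ (Φ T) z₀ v) =
      fderiv ℝ (fderiv ℝ P) z₀ v v := by
    intro v
    have h1 : ∀ r : ℝ, fderiv ℝ P (Φ T (z₀ + r • v)) (fderiv ℝ (Φ T) (z₀ + r • v) v) =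
        fderiv ℝ P (z₀ + r • v) v := by
      intro r
      have h2 : P ∘ Φ T = P := funext fun z => h.apply_flow T z
      conv_rhs => rw [← h2]
      rw [fderiv_comp _ (h.smooth_P.differentiable (by simp) _) (h.differentiable_flow T _)]
      rfl
    have h2 := (ContinuousLinearMap.apply ℝ ℝ v).hasFDerivAt.comp_hasDerivAt 0
      (hcomp (fderiv ℝ P) v (hP1.differentiable (by simp)))
    have h3 := (ContinuousLinearMap.apply ℝ E v).hasFDerivAt.comp_hasDerivAt 0
      (hcomp (fderiv ℝ (Φ T)) v (hΦ1.differentiable (by simp)))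
    have h4 : HasDerivAt (fun r : ℝ => fderiv ℝ P (Φ T (z₀ + r • v)))
        (fderiv ℝ (fderiv ℝ P) z₀ (fderiv ℝ (Φ T) z₀ v)) 0 := by
      refine HasFDerivAt.comp_hasDerivAt (l := fderiv ℝ P) (f := fun r : ℝ => Φ T (z₀ + r • v)) 0 ?_
        (hcomp (Φ T) v (h.differentiable_flow T))
      simpa [hper] using (hP1.differentiable (by simp) z₀).hasFDerivAt
    have h5 := h4.clm_apply h3
    have h6 := h5.congr_of_eventuallyEq (f₁ := fun r : ℝ => fderiv ℝ P (z₀ + r • v) v)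
      (Eventually.of_forall fun r => (h1 r).symm)
    have h7 := h2.unique h6
    simp only [ContinuousLinearMap.apply_apply, Function.comp_apply, zero_smul, add_zero, hper,
      hdP, zero_apply] at h7
    exact h7.symm
  have hML : ∀ v, fderiv ℝ (Φ T) z₀ (fderiv ℝ J z₀ v) = fderiv ℝ J z₀ (fderiv ℝ (Φ T) z₀ v) := by
    intro v
    have h3 := hcomp (fderiv ℝ (Φ T)) v (hΦ1.differentiable (by simp))
    have h4 := h3.clm_apply (hcomp J v (h.smooth_J.differentiable (by simp)))
    have h5 : HasDerivAt (fun r : ℝ => J (Φ T (z₀ + r • v)))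
        (fderiv ℝ J z₀ (fderiv ℝ (Φ T) z₀ v)) 0 := by
      refine HasFDerivAt.comp_hasDerivAt (l := J) (f := fun r : ℝ => Φ T (z₀ + r • v)) 0 ?_
        (hcomp (Φ T) v (h.differentiable_flow T))
      simpa [hper] using (h.smooth_J.differentiable (by simp) z₀).hasFDerivAt
    have h6 := h4.unique (h5.congr_of_eventuallyEq
      (Eventually.of_forall fun r => h.fderiv_flow_apply T (z₀ + r • v)))
    simpa [hJ] using h6
  obtain ⟨ν, θ, e, e₂, π₁, π₂, πb, hd, hco, hν, hLe, hLe₂, hMe, hq⟩ :=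
    exists_rotation_basis hdim (Q := fderiv ℝ (fderiv ℝ P) z₀) (L := fderiv ℝ J z₀)
      (M := fderiv ℝ (Φ T) z₀) hB hsymm hQb hQ
      (fun v w => by rw [hsymm, hskew])
      (by rw [h.bracket, hJ, map_zero]) hker hM hML
  exact ⟨ν, θ, e, e₂, π₁, π₂, πb, ⟨hd, hco, hν, hT, hJ, hLe, hLe₂, hper, hMe, hP, hP0, hdP, hq⟩⟩

end RotationBasis

section CircleAction

open Set Filter Topology Module
open scoped ContDiff

variable {E : Type} [NormedAddCommGroup E] [NormedSpace ℝ E]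

/-- Liouville's formula in dimension three, for a trace-free generator. -/
theorem hasDerivAt_det_of_trace_eq_zero (hdim : finrank ℝ E = 3) {W : ℝ → E →ₗ[ℝ] E}
    {N : E →ₗ[ℝ] E} {t : ℝ} (hW : ∀ v, HasDerivAt (fun s => W s v) (N (W t v)) t)
    (hN : LinearMap.trace ℝ E N = 0) : HasDerivAt (fun s => LinearMap.det (W s)) 0 t := by
  have : FiniteDimensional ℝ E := .of_finrank_pos (by omega)
  let 𝓑 := finBasisOfFinrankEq ℝ E hdim
  have hm : ∀ i j, HasDerivAt (fun s => LinearMap.toMatrix 𝓑 𝓑 (W s) i j)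
      ((LinearMap.toMatrix 𝓑 𝓑 N * LinearMap.toMatrix 𝓑 𝓑 (W t)) i j) t := by
    intro i j
    rw [← LinearMap.toMatrix_comp]
    simp only [LinearMap.toMatrix_apply, LinearMap.comp_apply]
    exact (LinearMap.toContinuousLinearMap (𝓑.coord i)).hasFDerivAt.comp_hasDerivAt t (hW (𝓑 j))
  rw [LinearMap.trace_eq_matrix_trace ℝ 𝓑, Matrix.trace_fin_three] at hN
  have hdet : ∀ s, LinearMap.det (W s) = (LinearMap.toMatrix 𝓑 𝓑 (W s)).det := fun s =>
    (LinearMap.det_toMatrix 𝓑 (W s)).symm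
  simp only [hdet, Matrix.det_fin_three]
  generalize LinearMap.toMatrix 𝓑 𝓑 N = n at hm hN
  have h1 := (((((((hm 0 0).mul (hm 1 1)).mul (hm 2 2)).sub
    (((hm 0 0).mul (hm 1 2)).mul (hm 2 1))).sub (((hm 0 1).mul (hm 1 0)).mul (hm 2 2))).add
    (((hm 0 1).mul (hm 1 2)).mul (hm 2 0))).add (((hm 0 2).mul (hm 1 0)).mul (hm 2 1))).sub
    (((hm 0 2).mul (hm 1 1)).mul (hm 2 0))
  refine h1.congr_deriv ?_
  simp only [Matrix.mul_apply, Fin.sum_univ_three, Pi.mul_apply]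
  generalize LinearMap.toMatrix 𝓑 𝓑 (W t) = m
  linear_combination m.det * hN - (n 0 0 + n 1 1 + n 2 2) * m.det_fin_three

variable [FiniteDimensional ℝ E]

/-- Reparametrising the joint action by its periods produces a circle action near the periodic
orbit. -/
theorem CommutingPair.exists_circle_action {B J : E → E} {P : E → ℝ} {Φ Ψ : ℝ → E → E}
    (h : CommutingPair B J P Φ Ψ) (hdim : finrank ℝ E = 3) {z₀ : E} {T ν θ : ℝ} {e e₂ : E}
    {π₁ π₂ πb : E →L[ℝ] ℝ} (hF : EllipticFrame B J P Φ z₀ T ν θ e e₂ π₁ π₂ πb)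
    (hbasis : ∀ O : Set E, IsOpen O → (∀ t, Φ t z₀ ∈ O) → ∃ ε > 0, ∀ z, P z < ε → z ∈ O)
    (htrB : ∀ z, LinearMap.trace ℝ E (fderiv ℝ B z) = 0)
    (htrJ : ∀ z, LinearMap.trace ℝ E (fderiv ℝ J z) = 0) :
    ∃ (A : ℝ → E → E) (u : E → E), ContDiff ℝ ∞ (fun q : ℝ × E => A q.1 q.2) ∧ ContDiff ℝ ∞ u ∧
      (∀ ζ z, P (A ζ z) = P z) ∧ (∀ z, A 0 z = z) ∧ (∀ ζ ζ' z, A (ζ + ζ') z = A ζ (A ζ' z)) ∧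
      (∃ ε > 0, ∀ z, P z < ε → A (2 * Real.pi) z = z) ∧
      (∀ ζ z, LinearMap.det (fderiv ℝ (A ζ) z : E →ₗ[ℝ] E) = 1) ∧
      (∀ ζ z, HasDerivAt (fun ζ => A ζ z) (u (A ζ z)) ζ) ∧
      (∀ t, u (Φ t z₀) = (T / (2 * Real.pi)) • B (Φ t z₀)) ∧
      (∀ z, fderiv ℝ B z (u z) = fderiv ℝ u z (B z)) ∧
      ∀ z, fderiv ℝ J z (u z) = fderiv ℝ u z (J z) := by
  obtain ⟨f₁, f₂, hf₁, hf₂, he₁, he₂, hf₁0, ε, hε, hper⟩ := hF.exists_period_functions h hbasis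
  have hπ : (2 * Real.pi) ≠ 0 := by positivity
  let a : E → ℝ := fun z => f₁ √(P z) / (2 * Real.pi)
  let b : E → ℝ := fun z => f₂ √(P z) / (2 * Real.pi)
  have ha : ContDiff ℝ ∞ a :=
    ((contDiffOn_comp_sqrt hf₁ he₁).comp_contDiff h.smooth_P hF.P_nonneg).div_const _
  have hb : ContDiff ℝ ∞ b :=
    ((contDiffOn_comp_sqrt hf₂ he₂).comp_contDiff h.smooth_P hF.P_nonneg).div_const _
  have hB := h.smooth_B
  have hJ := h.smooth_J
  let A : ℝ → E → E := fun ζ z => Φ (ζ * a z) (Ψ (ζ * b z) z)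
  let u : E → E := fun z => a z • B z + b z • J z
  have hu : ContDiff ℝ ∞ u := (ha.smul hB).add (hb.smul hJ)
  have hA : ContDiff ℝ ∞ (fun q : ℝ × E => A q.1 q.2) := by
    have : ContDiff ℝ ∞ (fun q : ℝ × E => (q.1 * a q.2, q.1 * b q.2, q.2)) := by fun_prop
    exact h.contDiff_action.comp this
  have hPA : ∀ ζ z, P (A ζ z) = P z := fun ζ z => h.apply_action _ _ _
  have hA0 : ∀ z, A 0 z = z := fun z => by
    simp [A, h.flow_B.zero, h.flow_J.zero]
  have hadd : ∀ ζ ζ' z, A (ζ + ζ') z = A ζ (A ζ' z) := by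
    intro ζ ζ' z
    have h1 : a (A ζ' z) = a z := by simp only [a, hPA]
    have h2 : b (A ζ' z) = b z := by simp only [b, hPA]
    have h3 : A ζ (A ζ' z) = Φ (ζ * a (A ζ' z)) (Ψ (ζ * b (A ζ' z)) (A ζ' z)) := rfl
    rw [h3, h1, h2]
    simp only [A]
    rw [add_mul, add_mul, h.action_add]
  have hA1 : ∀ z, HasDerivAt (fun ζ => A ζ z) (u z) 0 := by
    intro z
    have h1 : HasDerivAt (fun ζ : ℝ => ζ * a z) (a z) 0 := by
      simpa using (hasDerivAt_id (0 : ℝ)).mul_const (a z)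
    have h2 : HasDerivAt (fun ζ : ℝ => Ψ (ζ * b z) z) (b z • J z) 0 := by
      have h3 : HasDerivAt (fun ζ : ℝ => ζ * b z) (b z) 0 := by
        simpa using (hasDerivAt_id (0 : ℝ)).mul_const (b z)
      have h4 := h.flow_J.deriv (0 * b z) z
      have h5 := HasDerivAt.scomp (0 : ℝ) h4 h3
      rwa [zero_mul, h.flow_J.zero] at h5
    refine (HasFDerivAt.comp_hasDerivAt (l := fun q : ℝ × E => Φ q.1 q.2)
      (f := fun ζ : ℝ => (ζ * a z, Ψ (ζ * b z) z)) 0 (h.hasFDerivAt_flow (0 * a z) (Ψ (0 * b z) z))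
      (h1.prodMk h2)).congr_deriv ?_
    simp [h.flow_B.zero, h.flow_J.zero, h.fderiv_flow_zero, u]
  have hA2 : ∀ ζ z, HasDerivAt (fun ζ => A ζ z) (u (A ζ z)) ζ := by
    intro ζ z
    have h1 : HasDerivAt (fun η => A η (A ζ z)) (u (A ζ z)) (ζ - ζ) := by
      rw [sub_self]
      exact hA1 _
    refine (h1.comp_sub_const ζ ζ).congr_of_eventuallyEq (Eventually.of_forall fun s => ?_)
    simp only
    rw [← hadd, sub_add_cancel]
  have hinv : ∀ {c : E → ℝ} (_ : ContDiff ℝ ∞ c) (_ : ∀ z z', P z = P z' → c z = c z') (z : E),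
      fderiv ℝ c z (B z) = 0 ∧ fderiv ℝ c z (J z) = 0 := by
    intro c hc hcP z
    have h0 : ∀ y, HasFDerivAt c (fderiv ℝ c y) y := fun y =>
      (hc.differentiable (by simp) y).hasFDerivAt
    constructor
    · have h1 := (h0 (Φ 0 z)).comp_hasDerivAt 0 (h.flow_B.deriv 0 z)
      rw [h.flow_B.zero] at h1
      refine h1.unique ((hasDerivAt_const (0 : ℝ) (c z)).congr_of_eventuallyEq
        (Eventually.of_forall fun s => hcP _ _ (h.apply_flow s z)))
    · have h1 := (h0 (Ψ 0 z)).comp_hasDerivAt 0 (h.flow_J.deriv 0 z)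
      rw [h.flow_J.zero] at h1
      refine h1.unique ((hasDerivAt_const (0 : ℝ) (c z)).congr_of_eventuallyEq
        (Eventually.of_forall fun s => hcP _ _ (h.symm.apply_flow s z)))
  have hainv := hinv ha (fun z z' hz => by simp only [a, hz])
  have hbinv := hinv hb (fun z z' hz => by simp only [b, hz])
  have hdu : ∀ z, fderiv ℝ u z = (a z • fderiv ℝ B z + (fderiv ℝ a z).smulRight (B z)) +
      (b z • fderiv ℝ J z + (fderiv ℝ b z).smulRight (J z)) := fun z =>
    (((ha.differentiable (by simp) z).hasFDerivAt.smul
      (hB.differentiable (by simp) z).hasFDerivAt).add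
      ((hb.differentiable (by simp) z).hasFDerivAt.smul
      (hJ.differentiable (by simp) z).hasFDerivAt)).fderiv
  have htr : ∀ z, LinearMap.trace ℝ E (fderiv ℝ u z) = 0 := by
    intro z
    have h1 : ∀ (f : E →L[ℝ] ℝ) (x : E), ((f.smulRight x : E →L[ℝ] E) : E →ₗ[ℝ] E) =
      (f : E →ₗ[ℝ] ℝ).smulRight x := fun f x => rfl
    rw [hdu]
    simp only [ContinuousLinearMap.toLinearMap_add, ContinuousLinearMap.toLinearMap_smul, map_add, map_smul, h1,
      LinearMap.trace_smulRight, htrB, htrJ, ContinuousLinearMap.coe_coe, (hainv z).1, (hbinv z).2,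
      smul_zero, add_zero]
  have hflow : IsFlow u A := ⟨hA0, hA2⟩
  refine ⟨A, u, hA, hu, hPA, hA0, hadd, ⟨ε, hε, fun z hz => ?_⟩, ?_, hA2, ?_, ?_, ?_⟩
  · have h1 : 2 * Real.pi * a z = f₁ √(P z) := mul_div_cancel₀ _ hπ
    have h2 : 2 * Real.pi * b z = f₂ √(P z) := mul_div_cancel₀ _ hπ
    simp only [A, h1, h2]
    exact hper z hz
  · intro ζ z
    have h1 : ∀ t, HasDerivAt (fun s => LinearMap.det (fderiv ℝ (A s) z : E →ₗ[ℝ] E)) 0 t :=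
      fun t => hasDerivAt_det_of_trace_eq_zero hdim
        (fun v => hflow.hasDerivAt_fderiv hu hA t z v) (htr (A t z))
    have h2 := is_const_of_deriv_eq_zero (fun t => (h1 t).differentiableAt)
      (fun t => (h1 t).deriv) ζ 0
    rw [h2, show A 0 = id from funext hA0, fderiv_id]
    simp
  · intro t
    have h1 : P (Φ t z₀) = 0 := by rw [h.apply_flow, hF.P_eq_zero]
    have h2 : J (Φ t z₀) = 0 := by rw [← h.fderiv_flow_apply, hF.J_eq_zero, map_zero]
    simp [u, a, h1, h2, hf₁0]
  · intro z
    rw [hdu]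
    simp [u, (hainv z).1, (hbinv z).1, h.bracket]
  · intro z
    rw [hdu]
    simp [u, (hainv z).2, (hbinv z).2, h.bracket]

end CircleAction

section MagneticField

open Set Filter Topology Module
open scoped ContDiff

theorem inner_cross3 (a b w : R3) : ⟪cross3 a b, w⟫ = (a 1 * b 2 - a 2 * b 1) * w 0 +
    (a 2 * b 0 - a 0 * b 2) * w 1 + (a 0 * b 1 - a 1 * b 0) * w 2 := by
  simp only [PiLp.inner_apply, Fin.sum_univ_three, cross3, pt]
  simp [mul_comm]

theorem inner_gradient_apply (p : R3 → ℝ) (z w : R3) : ⟪gradient p z, w⟫ = fderiv ℝ p z w :=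
  InnerProductSpace.toDual_symm_apply

theorem fderiv_fderiv_eq_inner_cross3 {B J : R3 → R3} {p : R3 → ℝ} {z : R3}
    (hB : DifferentiableAt ℝ B z) (hJ : DifferentiableAt ℝ J z)
    (hp : DifferentiableAt ℝ (fderiv ℝ p) z)
    (hg : ∀ᶠ y in 𝓝 z, cross3 (J y) (B y) = gradient p y) (v w : R3) :
    fderiv ℝ (fderiv ℝ p) z v w =
      ⟪cross3 (fderiv ℝ J z v) (B z), w⟫ + ⟪cross3 (J z) (fderiv ℝ B z v), w⟫ := by
  have hl : HasDerivAt (fun r : ℝ => z + r • v) v 0 := by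
    simpa using ((hasDerivAt_id (0 : ℝ)).smul_const v).const_add z
  have hcomp : ∀ {F : Type} [NormedAddCommGroup F] [NormedSpace ℝ F] {f : R3 → F},
      DifferentiableAt ℝ f z → HasDerivAt (fun r : ℝ => f (z + r • v)) (fderiv ℝ f z v) 0 := by
    intro F _ _ f hf
    refine HasFDerivAt.comp_hasDerivAt (l := f) 0 ?_ hl
    simpa using hf.hasFDerivAt
  have h1 := (ContinuousLinearMap.apply ℝ ℝ w).hasFDerivAt.comp_hasDerivAt 0 (hcomp hp)
  have hB' : ∀ i, HasDerivAt (fun r : ℝ => B (z + r • v) i) (fderiv ℝ B z v i) 0 := fun i =>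
    (EuclideanSpace.proj i : R3 →L[ℝ] ℝ).hasFDerivAt.comp_hasDerivAt 0 (hcomp hB)
  have hJ' : ∀ i, HasDerivAt (fun r : ℝ => J (z + r • v) i) (fderiv ℝ J z v i) 0 := fun i =>
    (EuclideanSpace.proj i : R3 →L[ℝ] ℝ).hasFDerivAt.comp_hasDerivAt 0 (hcomp hJ)
  have h2 := ((((hJ' 1).mul (hB' 2)).sub ((hJ' 2).mul (hB' 1))).mul_const (w 0)).add
    ((((hJ' 2).mul (hB' 0)).sub ((hJ' 0).mul (hB' 2))).mul_const (w 1)) |>.add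
    ((((hJ' 0).mul (hB' 1)).sub ((hJ' 1).mul (hB' 0))).mul_const (w 2))
  have ht : Tendsto (fun r : ℝ => z + r • v) (𝓝 0) (𝓝 z) := by
    simpa using hl.continuousAt.tendsto
  have h3 := h1.unique (h2.congr_of_eventuallyEq (by
    filter_upwards [ht.eventually hg] with r hr
    refine (inner_gradient_apply p (z + r • v) w).symm.trans ?_
    rw [← hr, inner_cross3]
    rfl))
  refine Eq.trans (by rfl) (h3.trans ?_)
  simp only [inner_cross3, zero_smul, add_zero]
  ring

theorem divg_eq_sum (v : R3 → R3) (z : R3) : divg v z =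
    fderiv ℝ v z (e3 0) 0 + fderiv ℝ v z (e3 1) 1 + fderiv ℝ v z (e3 2) 2 := by
  rw [divg, LinearMap.trace_eq_matrix_trace ℝ (EuclideanSpace.basisFun (Fin 3) ℝ).toBasis,
    Matrix.trace_fin_three]
  simp [LinearMap.toMatrix_apply, e3]

theorem fderiv_apply_eq_sum (v : R3 → R3) (z w : R3) (i : Fin 3) : fderiv ℝ v z w i =
    w 0 * fderiv ℝ v z (e3 0) i + w 1 * fderiv ℝ v z (e3 1) i + w 2 * fderiv ℝ v z (e3 2) i := by
  have hw : w = w 0 • e3 0 + w 1 • e3 1 + w 2 • e3 2 := by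
    ext j
    fin_cases j <;> simp [e3]
  conv_lhs => rw [hw]
  simp

theorem fderiv_apply_comm_of_divg_eq_zero {B J : R3 → R3} {p : R3 → ℝ} {z : R3}
    (hB : DifferentiableAt ℝ B z) (hJ : DifferentiableAt ℝ J z)
    (hp : DifferentiableAt ℝ (fderiv ℝ p) z) (hp' : ∀ᶠ y in 𝓝 z, DifferentiableAt ℝ p y)
    (hg : ∀ᶠ y in 𝓝 z, cross3 (J y) (B y) = gradient p y) (hdB : divg B z = 0)
    (hdJ : divg J z = 0) : fderiv ℝ J z (B z) = fderiv ℝ B z (J z) := by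
  have hsymm : ∀ v w, fderiv ℝ (fderiv ℝ p) z v w = fderiv ℝ (fderiv ℝ p) z w v := fun v w =>
    second_derivative_symmetric_of_eventually (hp'.mono fun y hy => hy.hasFDerivAt)
      hp.hasFDerivAt v w
  simp only [fderiv_fderiv_eq_inner_cross3 hB hJ hp hg, inner_cross3] at hsymm
  have h01 := hsymm (e3 0) (e3 1)
  have h02 := hsymm (e3 0) (e3 2)
  have h12 := hsymm (e3 1) (e3 2)
  rw [divg_eq_sum] at hdB hdJ
  have a00 : e3 0 0 = 1 := by simp [e3]
  have a01 : e3 0 1 = 0 := by simp [e3]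
  have a02 : e3 0 2 = 0 := by simp [e3]
  have a10 : e3 1 0 = 0 := by simp [e3]
  have a11 : e3 1 1 = 1 := by simp [e3]
  have a12 : e3 1 2 = 0 := by simp [e3]
  have a20 : e3 2 0 = 0 := by simp [e3]
  have a21 : e3 2 1 = 0 := by simp [e3]
  have a22 : e3 2 2 = 1 := by simp [e3]
  simp only [a00, a01, a02, a10, a11, a12, a20, a21, a22, mul_zero, mul_one, add_zero,
    zero_add] at h01 h02 h12
  ext i
  rw [fderiv_apply_eq_sum J z (B z), fderiv_apply_eq_sum B z (J z)]
  fin_cases i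
  · simp only [Fin.zero_eta]
    linear_combination h12 + B z 0 * hdJ - J z 0 * hdB
  · simp only [Fin.mk_one]
    linear_combination -h02 + B z 1 * hdJ - J z 1 * hdB
  · simp only [Fin.reduceFinMk]
    linear_combination h01 + B z 2 * hdJ - J z 2 * hdB

/-- A symmetric form vanishing on `b` and positive on the complement of `b` is positive off `ℝ b`. -/
theorem pos_of_pos_on_orthogonal {Q : R3 →L[ℝ] R3 →L[ℝ] ℝ} {b : R3} (hb : b ≠ 0)
    (hsymm : ∀ v w, Q v w = Q w v) (hQb : ∀ v, Q v b = 0)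
    (hQ : ∀ u : R3, u ≠ 0 → ⟪u, b⟫ = 0 → 0 < Q u u) {v : R3} (hv : ∀ c : ℝ, v ≠ c • b) :
    0 < Q v v := by
  have hbb : ⟪b, b⟫ ≠ 0 := inner_self_ne_zero.2 hb
  set c := ⟪v, b⟫ / ⟪b, b⟫ with hc
  have h1 := hQ (v - c • b) (sub_ne_zero.2 (hv c)) (by
    rw [inner_sub_left, real_inner_smul_left, hc, div_mul_cancel₀ _ hbb, sub_self])
  have h2 : ∀ w, Q b w = 0 := fun w => by rw [hsymm, hQb]
  simpa [hQb, h2] using h1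

theorem sum_apply_pos_of_pos_on_orthogonal {Q : R3 →L[ℝ] R3 →L[ℝ] ℝ} {b : R3} (hb : b ≠ 0)
    (hsymm : ∀ v w, Q v w = Q w v) (hQb : ∀ v, Q v b = 0)
    (hQ : ∀ u : R3, u ≠ 0 → ⟪u, b⟫ = 0 → 0 < Q u u) :
    0 < Q (e3 0) (e3 0) + Q (e3 1) (e3 1) + Q (e3 2) (e3 2) := by
  have hnn : ∀ v, 0 ≤ Q v v := by
    intro v
    by_cases hv : ∀ c : ℝ, v ≠ c • b
    · exact (pos_of_pos_on_orthogonal hb hsymm hQb hQ hv).le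
    · push Not at hv
      obtain ⟨c, rfl⟩ := hv
      simp [hQb]
  by_cases h0 : ∀ c : ℝ, e3 0 ≠ c • b
  · linarith [pos_of_pos_on_orthogonal hb hsymm hQb hQ h0, hnn (e3 1), hnn (e3 2)]
  · push Not at h0
    obtain ⟨c, hc⟩ := h0
    have h1 : ∀ d : ℝ, e3 1 ≠ d • b := by
      intro d hd
      have a1 := congrArg (fun v : R3 => v 0) hc
      have a2 := congrArg (fun v : R3 => v 1) hc
      have a3 := congrArg (fun v : R3 => v 1) hd
      simp [e3] at a1 a2 a3
      rcases a2 with rfl | h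
      · simp at a1
      · simp [h] at a3
    linarith [pos_of_pos_on_orthogonal hb hsymm hQb hQ h1, hnn (e3 0), hnn (e3 2)]

/-- The rotation frame at a point of an elliptic periodic orbit. -/
theorem exists_ellipticFrame_of_cross3 {B J : R3 → R3} {P : R3 → ℝ} {Φ Ψ : ℝ → R3 → R3}
    (h : CommutingPair B J P Φ Ψ) {z₀ : R3} {T : ℝ} (hT : 0 < T)
    (hper : Φ T z₀ = z₀) (hB : B z₀ ≠ 0) (hJ : J z₀ = 0) (hP : P z₀ = 0) (hP0 : ∀ z, 0 ≤ P z)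
    (hg : ∀ᶠ z in 𝓝 z₀, cross3 (J z) (B z) = gradient P z)
    (hQ : ∀ u : R3, u ≠ 0 → ⟪u, B z₀⟫ = 0 → 0 < fderiv ℝ (fderiv ℝ P) z₀ u u) :
    ∃ (ν θ : ℝ) (e e₂ : R3) (π₁ π₂ πb : R3 →L[ℝ] ℝ),
      EllipticFrame B J P Φ z₀ T ν θ e e₂ π₁ π₂ πb := by
  have hP1 : ContDiff ℝ ∞ (fderiv ℝ P) := h.smooth_P.fderiv_right (by simp)
  have hsymm : ∀ v w, fderiv ℝ (fderiv ℝ P) z₀ v w = fderiv ℝ (fderiv ℝ P) z₀ w v :=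
    second_derivative_symmetric (fun y => (h.smooth_P.differentiable (by simp) y).hasFDerivAt)
      (hP1.differentiable (by simp) z₀).hasFDerivAt
  have hform : ∀ v w, fderiv ℝ (fderiv ℝ P) z₀ v w =
      ⟪cross3 (fderiv ℝ J z₀ v) (B z₀), w⟫ := by
    intro v w
    rw [fderiv_fderiv_eq_inner_cross3 (h.smooth_B.differentiable (by simp) z₀)
      (h.smooth_J.differentiable (by simp) z₀) (hP1.differentiable (by simp) z₀) hg, hJ,
      inner_cross3 0]
    simp
  have hQb : ∀ v, fderiv ℝ (fderiv ℝ P) z₀ v (B z₀) = 0 := fun v => by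
    rw [hform, inner_cross3]
    ring
  have hQ' : ∀ v, (∀ c : ℝ, v ≠ c • B z₀) → 0 < fderiv ℝ (fderiv ℝ P) z₀ v v := fun v hv =>
    pos_of_pos_on_orthogonal hB hsymm hQb hQ hv
  refine h.exists_ellipticFrame (by simp) hT hper hB hJ hP hP0 hQb hQ' ?_ ?_
  · intro v w
    rw [hform, hform, inner_cross3, inner_cross3]
    ring
  · intro v hv c hc
    have h1 := hQ' v hv
    rw [hform, hc, inner_cross3] at h1
    simp only [PiLp.smul_apply, smul_eq_mul] at h1
    ring_nf at h1
    exact lt_irrefl _ h1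

end MagneticField

section Localisation

open Set Filter Topology Module
open scoped ContDiff

theorem pos_of_hasDerivAt_of_pos {g g' g'' : ℝ → ℝ} {s : ℝ} (hs : 0 < s)
    (h₁ : ∀ r ∈ Icc 0 s, HasDerivAt g (g' r) r) (h₂ : ∀ r ∈ Icc 0 s, HasDerivAt g' (g'' r) r)
    (h₃ : ∀ r ∈ Icc 0 s, 0 < g'' r) (hg : g 0 = 0) (hg' : g' 0 = 0) : 0 < g s := by
  have hmono : StrictMonoOn g' (Icc 0 s) :=
    strictMonoOn_of_deriv_pos (convex_Icc 0 s)
      (fun r hr => (h₂ r hr).continuousAt.continuousWithinAt) fun r hr => by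
        have hr' := interior_subset hr
        rw [(h₂ r hr').deriv]
        exact h₃ r hr'
  have hmono' : StrictMonoOn g (Icc 0 s) :=
    strictMonoOn_of_deriv_pos (convex_Icc 0 s)
      (fun r hr => (h₁ r hr).continuousAt.continuousWithinAt) fun r hr => by
        have hr' := interior_subset hr
        rw [(h₁ r hr').deriv, ← hg']
        rw [interior_Icc] at hr
        exact hmono ⟨le_rfl, hs.le⟩ hr' hr.1
  rw [← hg]
  exact hmono' ⟨le_rfl, hs.le⟩ ⟨hs.le, le_rfl⟩ hs

variable {E : Type} [NormedAddCommGroup E] [InnerProductSpace ℝ E]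

theorem inner_sub_eq_zero_of_infDist_eq {c : ℝ → E} {v z : E} {t : ℝ} (hc : HasDerivAt c v t)
    (ht : Metric.infDist z (range c) = dist z (c t)) : ⟪z - c t, v⟫ = 0 := by
  have hmin : IsLocalMin (fun r => ⟪z - c r, z - c r⟫) t := by
    refine Eventually.of_forall fun r => ?_
    have h1 := Metric.infDist_le_dist_of_mem (x := z) (mem_range_self (f := c) r)
    rw [ht, dist_eq_norm, dist_eq_norm] at h1
    simp only [real_inner_self_eq_norm_sq]
    gcongr
  have hd : HasDerivAt (fun r => z - c r) (-v) t := by simpa using hc.const_sub z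
  have := hmin.hasDerivAt_eq_zero (hd.inner ℝ hd)
  simp only [inner_neg_left, inner_neg_right, real_inner_comm (z - c t) v] at this
  linarith [real_inner_comm (z - c t) v]

variable [FiniteDimensional ℝ E]

theorem exists_pos_of_hess_pos {U : Set E} (hU : IsOpen U) {q : E → ℝ}
    (hq : ContDiffOn ℝ ∞ q U) {B : E → E} {c : ℝ → E} (hB : ContinuousOn B (range c))
    (hc : ∀ t, HasDerivAt c (B (c t)) t) (hcU : range c ⊆ U) (hK : IsCompact (range c))
    (h0 : ∀ y ∈ range c, q y = 0) (h1 : ∀ y ∈ range c, fderiv ℝ q y = 0)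
    (h2 : ∀ y ∈ range c, ∀ w : E, w ≠ 0 → ⟪w, B y⟫ = 0 → 0 < fderiv ℝ (fderiv ℝ q) y w w) :
    ∃ δ > 0, ∀ z, Metric.infDist z (range c) < δ → z ∈ U ∧ (z ∉ range c → 0 < q z) := by
  have hq1 : ContDiffOn ℝ ∞ (fderiv ℝ q) U := hq.fderiv_of_isOpen hU (by simp)
  have hq2 : ContDiffOn ℝ ∞ (fderiv ℝ (fderiv ℝ q)) U := hq1.fderiv_of_isOpen hU (by simp)
  set K : Set (E × E) := (range c ×ˢ Metric.sphere (0 : E) 1) ∩ {k | ⟪k.2, B k.1⟫ = 0} with hKdef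
  have hKc : IsCompact K := by
    have hS : IsCompact (range c ×ˢ Metric.sphere (0 : E) 1) := hK.prod (isCompact_sphere 0 1)
    refine hS.of_isClosed_subset ?_ inter_subset_left
    have : ContinuousOn (fun k : E × E => ⟪k.2, B k.1⟫) (range c ×ˢ Metric.sphere (0 : E) 1) :=
      continuousOn_snd.inner (hB.comp continuousOn_fst fun k hk => hk.1)
    exact this.preimage_isClosed_of_isClosed hS.isClosed isClosed_singleton
  have hev := hKc.eventually_forall_of_forall_eventually (x₀ := (0 : ℝ))
    (P := fun s k => k.1 + s • k.2 ∈ U ∧ 0 < fderiv ℝ (fderiv ℝ q) (k.1 + s • k.2) k.2 k.2) (by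
      rintro ⟨y, w⟩ ⟨⟨hy, hw⟩, hyw⟩
      have hcont : ContinuousAt (fun x : ℝ × E × E => x.2.1 + x.1 • x.2.2) (0, y, w) := by
        fun_prop
      have hyU : U ∈ 𝓝 (y + (0 : ℝ) • w) := by simpa using hU.mem_nhds (hcU hy)
      have hw0 : w ≠ 0 := by
        rintro rfl
        simp at hw
      refine (hcont.eventually hyU).and ?_
      have hc2 : ContinuousAt (fun x : ℝ × E × E => fderiv ℝ (fderiv ℝ q) (x.2.1 + x.1 • x.2.2))
          (0, y, w) :=
        ContinuousAt.comp' (g := fderiv ℝ (fderiv ℝ q))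
          (f := fun x : ℝ × E × E => x.2.1 + x.1 • x.2.2) (hq2.continuousOn.continuousAt hyU) hcont
      have hw2 : ContinuousAt (fun x : ℝ × E × E => x.2.2) (0, y, w) := by fun_prop
      have := (hc2.clm_apply hw2).clm_apply hw2
      exact this.eventually (lt_mem_nhds (by simpa using h2 y hy w hw0 hyw)))
  obtain ⟨δ, hδ, hev⟩ := Metric.eventually_nhds_iff.1 hev
  refine ⟨δ, hδ, fun z hz => ?_⟩
  obtain ⟨y, hy, hyz⟩ := hK.exists_infDist_eq_dist (range_nonempty c) z
  by_cases hzy : z = y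
  · exact ⟨hzy ▸ hcU hy, fun h => absurd (hzy ▸ hy) h⟩
  obtain ⟨t, rfl⟩ := hy
  have hs : 0 < ‖z - c t‖ := norm_pos_iff.2 (sub_ne_zero.2 hzy)
  set s := ‖z - c t‖ with hsdef
  rw [hyz, dist_eq_norm, ← hsdef] at hz
  set w := s⁻¹ • (z - c t) with hw
  have hwK : (c t, w) ∈ K := by
    refine ⟨⟨mem_range_self t, ?_⟩, ?_⟩
    · rw [mem_sphere_zero_iff_norm, hw, norm_smul, norm_inv, norm_norm, ← hsdef,
        inv_mul_cancel₀ hs.ne']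
    · show ⟪w, B (c t)⟫ = 0
      rw [hw, real_inner_smul_left, inner_sub_eq_zero_of_infDist_eq (hc t) hyz, mul_zero]
  have hzw : c t + s • w = z := by rw [hw, smul_inv_smul₀ hs.ne']; abel
  have hr : ∀ r ∈ Icc 0 s, c t + r • w ∈ U ∧ 0 < fderiv ℝ (fderiv ℝ q) (c t + r • w) w w := by
    intro r hr
    refine hev ?_ _ hwK
    rw [Real.dist_eq, sub_zero, abs_of_nonneg hr.1]
    exact hr.2.trans_lt hz
  refine ⟨hzw ▸ (hr s ⟨hs.le, le_rfl⟩).1, fun _ => ?_⟩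
  have hl : ∀ r, HasDerivAt (fun r : ℝ => c t + r • w) w r := fun r => by
    simpa using ((hasDerivAt_id r).smul_const w).const_add (c t)
  have := pos_of_hasDerivAt_of_pos (g := fun r => q (c t + r • w))
    (g' := fun r => fderiv ℝ q (c t + r • w) w)
    (g'' := fun r => fderiv ℝ (fderiv ℝ q) (c t + r • w) w w) hs
    (fun r hr' => HasFDerivAt.comp_hasDerivAt (l := q) r
      ((hq.contDiffAt (hU.mem_nhds (hr r hr').1)).differentiableAt (by simp)).hasFDerivAt (hl r))
    (fun r hr' => (ContinuousLinearMap.apply ℝ ℝ w).hasFDerivAt.comp_hasDerivAt r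
      (HasFDerivAt.comp_hasDerivAt (l := fderiv ℝ q) r
      ((hq1.contDiffAt (hU.mem_nhds (hr r hr').1)).differentiableAt (by simp)).hasFDerivAt
        (hl r)))
    (fun r hr' => (hr r hr').2) (by simpa using h0 _ (mem_range_self t))
    (by simp [h1 _ (mem_range_self t)])
  rwa [hzw] at this

theorem exists_cutoff {U γ : Set E} (hU : IsOpen U) {q : E → ℝ} (hq : ContDiffOn ℝ ∞ q U)
    (hγ : IsCompact γ) (hγ0 : γ.Nonempty) (h0 : ∀ y ∈ γ, q y = 0) {δ : ℝ} (hδ : 0 < δ)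
    (hpos : ∀ z, Metric.infDist z γ < δ → z ∈ U ∧ (z ∉ γ → 0 < q z)) :
    ∃ (η : E → ℝ) (m : ℝ), HasCompactSupport η ∧
      (∀ z, (z ∈ U ∧ ContDiffAt ℝ ∞ η z ∧ ∃ a : ℝ, fderiv ℝ η z = a • fderiv ℝ q z) ∨
        η =ᶠ[𝓝 z] 0) ∧
      (∀ z, 0 ≤ m - η z * (m - q z)) ∧ (∀ y ∈ γ, η =ᶠ[𝓝 y] 1) ∧
      ∀ O, IsOpen O → γ ⊆ O → ∃ ε > 0, ∀ z, m - η z * (m - q z) < ε →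
        z ∈ O ∧ z ∈ U ∧ η =ᶠ[𝓝 z] 1 := by
  classical
  set d := fun z => Metric.infDist z γ with hd
  have hdc : Continuous d := Metric.continuous_infDist_pt γ
  have hball : ∀ r, IsCompact {z | d z ≤ r} := by
    intro r
    obtain ⟨x, hx⟩ := hγ0
    obtain ⟨R, hR⟩ := hγ.isBounded.subset_closedBall x
    refine Metric.isCompact_of_isClosed_isBounded (isClosed_le hdc continuous_const)
      ((Metric.isBounded_closedBall (x := x) (r := r + R)).subset fun z hz => ?_)
    obtain ⟨y, hy, hzy⟩ := hγ.exists_infDist_eq_dist ⟨x, hx⟩ z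
    have h1 : dist z y ≤ r := hzy ▸ hz
    have h2 : dist y x ≤ R := hR hy
    exact (dist_triangle z y x).trans (add_le_add h1 h2)
  have hdγ : ∀ y ∈ γ, d y = 0 := fun y hy => Metric.infDist_zero_of_mem hy
  have hqU : ContinuousOn q U := hq.continuousOn
  set r := δ / 2 with hr
  have hrδ : r < δ := by linarith
  have hr0 : 0 < r := by linarith
  have hnn : ∀ z, d z < δ → 0 ≤ q z := fun z hz => by
    by_cases hzγ : z ∈ γ
    · exact (h0 z hzγ).ge
    · exact ((hpos z hz).2 hzγ).le
  have hlow : ∀ S, IsCompact S → S ⊆ {z | d z ≤ r} → (∀ z ∈ S, z ∉ γ) →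
      ∃ m > 0, ∀ z ∈ S, m ≤ q z := by
    intro S hS hSr hSγ
    have := hS.exists_forall_le' (f := q) (hqU.mono fun z hz => (hpos z ((hSr hz).trans_lt hrδ)).1)
      (a := 0) (fun z hz => (hpos z ((hSr hz).trans_lt hrδ)).2 (hSγ z hz))
    exact this
  obtain ⟨m, hm, hmq⟩ := hlow {z | d z = r}
    ((hball r).of_isClosed_subset (isClosed_eq hdc continuous_const) fun z hz => le_of_eq hz)
    (fun z hz => le_of_eq hz) (fun z hz hzγ => by
      have := hdγ z hzγ
      have hz' : d z = r := hz
      linarith)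
  let ξ : ContDiffBump (0 : ℝ) := ⟨m / 4, m / 2, by linarith, by linarith⟩
  set η : E → ℝ := fun z => if d z < r then ξ (q z) else 0 with hη
  have hξ0 : ∀ x, m / 2 ≤ x → ξ x = 0 := fun x hx => by
    refine ξ.zero_of_le_dist ?_
    rw [Real.dist_eq, sub_zero, abs_of_nonneg (by linarith)]
    exact hx
  have hη1 : ∀ z, d z < r → η =ᶠ[𝓝 z] fun y => ξ (q y) := fun z hz => by
    filter_upwards [hdc.continuousAt.eventually (gt_mem_nhds hz)] with y hy
    exact if_pos hy
  have hη0 : ∀ z, η z ≠ 0 → d z < r := fun z hz => by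
    by_contra hz'
    exact hz (if_neg hz')
  have hηI : ∀ z, 0 ≤ η z ∧ η z ≤ 1 := fun z => by
    simp only [hη]
    split_ifs
    · exact ⟨ξ.nonneg, ξ.le_one⟩
    · exact ⟨le_rfl, zero_le_one⟩
  have hη_one : ∀ z, d z < r → q z < m / 4 → η =ᶠ[𝓝 z] 1 := fun z hz hlt => by
    have hzU := (hpos z (hz.trans hrδ)).1
    filter_upwards [hη1 z hz, hdc.continuousAt.eventually (gt_mem_nhds hz),
      (hqU.continuousAt (hU.mem_nhds hzU)).eventually (gt_mem_nhds hlt)] with y hy hyr hyq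
    rw [hy]
    refine ξ.one_of_mem_closedBall ?_
    rw [Metric.mem_closedBall, Real.dist_eq, sub_zero, abs_of_nonneg (hnn y (hyr.trans hrδ))]
    exact hyq.le
  refine ⟨η, m, HasCompactSupport.intro (hball r) fun z hz => ?_, fun z => ?_, fun z => ?_,
    fun z hz => ?_, fun O hO hγO => ?_⟩
  · by_contra h
    exact hz (hη0 z h).le
  · rcases lt_trichotomy (d z) r with hz | hz | hz
    · left
      have hzU := (hpos z (hz.trans hrδ)).1
      have hqz := hq.contDiffAt (hU.mem_nhds hzU)
      refine ⟨hzU, (ξ.contDiff.contDiffAt.comp z hqz).congr_of_eventuallyEq (hη1 z hz),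
        deriv ξ (q z), ?_⟩
      rw [(hη1 z hz).fderiv_eq]
      have h1 : HasDerivAt ξ (deriv ξ (q z)) (q z) :=
        (ξ.contDiff.differentiable (n := ∞) (by simp) _).hasDerivAt
      exact (h1.comp_hasFDerivAt z (hqz.differentiableAt (by simp)).hasFDerivAt).fderiv
    · right
      have hzU := (hpos z (hz.trans_lt hrδ)).1
      have hlt : m / 2 < q z := by linarith [hmq z hz]
      filter_upwards [(hqU.continuousAt (hU.mem_nhds hzU)).eventually (lt_mem_nhds hlt)] with y hy
      simp only [hη, hξ0 _ hy.le, ite_self, Pi.zero_apply]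
    · right
      filter_upwards [hdc.continuousAt.eventually (lt_mem_nhds hz)] with y hy
      exact if_neg hy.not_gt
  · by_cases hz : η z = 0
    · simp [hz, hm.le]
    · have := hnn z ((hη0 z hz).trans hrδ)
      nlinarith [hηI z]
  · refine hη_one z ?_ ?_
    · rw [hdγ z hz]
      exact hr0
    · rw [h0 z hz]
      linarith
  · obtain ⟨ε, hε, hεq⟩ := hlow ({z | d z ≤ r} \ O) ((hball r).diff hO) sdiff_subset
      fun z hz hzγ => hz.2 (hγO hzγ)
    refine ⟨min ε (m / 4), lt_min hε (by linarith), fun z hz => ?_⟩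
    rw [lt_min_iff] at hz
    have hzη : η z ≠ 0 := fun h => by
      rw [h] at hz
      linarith
    have hzr := hη0 z hzη
    have hzU := (hpos z (hzr.trans hrδ)).1
    have hqz := hnn z (hzr.trans hrδ)
    have hqm : q z < m := by
      by_contra! hqm
      have : η z * (m - q z) ≤ 0 := mul_nonpos_of_nonneg_of_nonpos (hηI z).1 (by linarith)
      linarith
    have hqP : q z ≤ m - η z * (m - q z) := by nlinarith [hηI z]
    refine ⟨?_, hzU, ?_⟩
    · by_contra hzO
      linarith [hεq z ⟨hzr.le, hzO⟩]
    · exact hη_one z hzr (by linarith)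

end Localisation

section Reduction

open Set Filter Topology Module
open scoped ContDiff

theorem contDiff_smul_of_cutoff {E F : Type} [NormedAddCommGroup E] [NormedSpace ℝ E]
    [NormedAddCommGroup F] [NormedSpace ℝ F] {U : Set E} (hU : IsOpen U) {η : E → ℝ} {f : E → F}
    (hη : ∀ z, (z ∈ U ∧ ContDiffAt ℝ ∞ η z) ∨ η =ᶠ[𝓝 z] 0) (hf : ContDiffOn ℝ ∞ f U) :
    ContDiff ℝ ∞ fun z => η z • f z := by
  rw [contDiff_iff_contDiffAt]
  intro z
  rcases hη z with ⟨hz, hηz⟩ | hz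
  · exact hηz.smul (hf.contDiffAt (hU.mem_nhds hz))
  · refine (contDiffAt_const (c := (0 : F))).congr_of_eventuallyEq ?_
    filter_upwards [hz] with y hy
    rw [hy, Pi.zero_apply, zero_smul]

theorem divg_smul {η : R3 → ℝ} {B : R3 → R3} {z : R3} (hη : DifferentiableAt ℝ η z)
    (hB : DifferentiableAt ℝ B z) :
    divg (fun y => η y • B y) z = η z * divg B z + fderiv ℝ η z (B z) := by
  have hw : B z = B z 0 • e3 0 + B z 1 • e3 1 + B z 2 • e3 2 := by
    ext j
    fin_cases j <;> simp [e3]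
  have h := congrArg (fderiv ℝ η z) hw
  simp only [map_add, map_smul, smul_eq_mul] at h
  rw [divg_eq_sum, divg_eq_sum, fderiv_fun_smul hη hB, h]
  simp
  ring

theorem fderiv_smul_apply_of_eq_zero {E F : Type} [NormedAddCommGroup E] [NormedSpace ℝ E]
    [NormedAddCommGroup F] [NormedSpace ℝ F] {η : E → ℝ} {f : E → F} {z v : E}
    (hη : DifferentiableAt ℝ η z) (hf : DifferentiableAt ℝ f z) (hv : fderiv ℝ η z v = 0) :
    fderiv ℝ (fun y => η y • f y) z v = η z • fderiv ℝ f z v := by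
  rw [fderiv_fun_smul hη hf]
  simp [hv]

theorem fderiv_eq_zero_of_eventuallyEq_zero {E F : Type} [NormedAddCommGroup E] [NormedSpace ℝ E]
    [NormedAddCommGroup F] [NormedSpace ℝ F] {η : E → ℝ} {f : E → F} {z : E}
    (hη : η =ᶠ[𝓝 z] 0) : fderiv ℝ (fun y => η y • f y) z = 0 := by
  have : (fun y => η y • f y) =ᶠ[𝓝 z] fun _ => 0 := by
    filter_upwards [hη] with y hy
    rw [hy, Pi.zero_apply, zero_smul]
  rw [this.fderiv_eq, fderiv_const_apply]

theorem exists_isFlow_of_hasCompactSupport {f : R3 → R3} (hf : ContDiff ℝ ∞ f)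
    (hc : HasCompactSupport f) : ∃ Φ, IsFlow f Φ := by
  obtain ⟨K, hK⟩ := hf.lipschitzWith_of_hasCompactSupport hc (by simp)
  obtain ⟨M, hM⟩ := hc.exists_bound_of_continuous hf.continuous
  exact exists_isFlow hK (M := M.toNNReal) fun x => (hM x).trans (Real.le_coe_toNNReal M)

namespace IntegrableMagneticField

variable {U : Set R3} {B J : R3 → R3} {q : R3 → ℝ} (h : IntegrableMagneticField U B J q)

include h

theorem differentiableAt_B {z : R3} (hz : z ∈ U) : DifferentiableAt ℝ B z :=
  (h.smooth_B.contDiffAt (h.isOpen_U.mem_nhds hz)).differentiableAt (by simp)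

theorem differentiableAt_J {z : R3} (hz : z ∈ U) : DifferentiableAt ℝ J z :=
  (h.smooth_J.contDiffAt (h.isOpen_U.mem_nhds hz)).differentiableAt (by simp)

theorem differentiableAt_p {z : R3} (hz : z ∈ U) : DifferentiableAt ℝ q z :=
  (h.smooth_p.contDiffAt (h.isOpen_U.mem_nhds hz)).differentiableAt (by simp)

theorem differentiableAt_fderiv_p {z : R3} (hz : z ∈ U) : DifferentiableAt ℝ (fderiv ℝ q) z :=
  ((h.smooth_p.fderiv_of_isOpen (m := ∞) h.isOpen_U (by simp)).contDiffAt
    (h.isOpen_U.mem_nhds hz)).differentiableAt (by simp)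

theorem fderiv_p_B {z : R3} (hz : z ∈ U) : fderiv ℝ q z (B z) = 0 := by
  rw [← inner_gradient_apply, ← h.hamiltonian z hz, inner_cross3]
  ring

theorem fderiv_p_J {z : R3} (hz : z ∈ U) : fderiv ℝ q z (J z) = 0 := by
  rw [← inner_gradient_apply, ← h.hamiltonian z hz, inner_cross3]
  ring

theorem eventually_hamiltonian {z : R3} (hz : z ∈ U) :
    ∀ᶠ y in 𝓝 z, cross3 (J y) (B y) = gradient q y :=
  Filter.mem_of_superset (h.isOpen_U.mem_nhds hz) h.hamiltonian

theorem bracket {z : R3} (hz : z ∈ U) : fderiv ℝ J z (B z) = fderiv ℝ B z (J z) :=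
  fderiv_apply_comm_of_divg_eq_zero (h.differentiableAt_B hz) (h.differentiableAt_J hz)
    (h.differentiableAt_fderiv_p hz)
    (Filter.mem_of_superset (h.isOpen_U.mem_nhds hz) fun _ hy => h.differentiableAt_p hy)
    (h.eventually_hamiltonian hz) (h.div_B z hz) (h.div_J z hz)

theorem exists_commutingPair {γ : Set R3} (hγ : IsCompact γ) (hγ0 : γ.Nonempty)
    (h0 : ∀ y ∈ γ, q y = 0) {δ : ℝ} (hδ : 0 < δ)
    (hpos : ∀ z, Metric.infDist z γ < δ → z ∈ U ∧ (z ∉ γ → 0 < q z)) :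
    ∃ (B' J' : R3 → R3) (P : R3 → ℝ) (Φ Ψ : ℝ → R3 → R3), CommutingPair B' J' P Φ Ψ ∧
      (∀ z, divg B' z = 0) ∧ (∀ z, divg J' z = 0) ∧ (∀ z, 0 ≤ P z) ∧
      (∀ y ∈ γ, B' =ᶠ[𝓝 y] B ∧ J' =ᶠ[𝓝 y] J ∧ P =ᶠ[𝓝 y] q) ∧
      ∀ O, IsOpen O → γ ⊆ O → ∃ ε > 0, ∀ z, P z < ε →
        z ∈ O ∧ z ∈ U ∧ B' =ᶠ[𝓝 z] B ∧ J' =ᶠ[𝓝 z] J := by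
  obtain ⟨η, m, hηc, hη, hP0, hηγ, hbasis⟩ :=
    exists_cutoff h.isOpen_U h.smooth_p hγ hγ0 h0 hδ hpos
  have hη' : ∀ z, (z ∈ U ∧ ContDiffAt ℝ ∞ η z) ∨ η =ᶠ[𝓝 z] 0 := fun z =>
    (hη z).imp_left fun hz => ⟨hz.1, hz.2.1⟩
  have hB := contDiff_smul_of_cutoff h.isOpen_U hη' h.smooth_B
  have hJ := contDiff_smul_of_cutoff h.isOpen_U hη' h.smooth_J
  have hR := contDiff_smul_of_cutoff h.isOpen_U hη' (contDiffOn_const (c := m).sub h.smooth_p)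
  have hηB : ∀ z, (z ∈ U ∧ DifferentiableAt ℝ η z ∧ fderiv ℝ η z (B z) = 0 ∧
      fderiv ℝ η z (J z) = 0) ∨ η =ᶠ[𝓝 z] 0 := fun z =>
    (hη z).imp_left fun ⟨hz, hd, a, ha⟩ => ⟨hz, hd.differentiableAt (by simp),
      by rw [ha, smul_apply, h.fderiv_p_B hz, smul_zero],
      by rw [ha, smul_apply, h.fderiv_p_J hz, smul_zero]⟩
  obtain ⟨Φ, hΦ⟩ := exists_isFlow_of_hasCompactSupport hB hηc.smul_right
  obtain ⟨Ψ, hΨ⟩ := exists_isFlow_of_hasCompactSupport hJ hηc.smul_right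
  have hfP : ∀ z, fderiv ℝ (fun z => m - η z * (m - q z)) z =
      -fderiv ℝ (fun z => η z • (m - q z)) z := fun z => by
    simp only [← smul_eq_mul (a := η _)]
    rw [fderiv_const_sub]
  have hdR : ∀ {z}, z ∈ U → DifferentiableAt ℝ (fun z => m - q z) z := fun hz =>
    (h.differentiableAt_p hz).const_sub m
  have hone : ∀ z, η =ᶠ[𝓝 z] 1 → (fun y => η y • B y) =ᶠ[𝓝 z] B ∧
      (fun y => η y • J y) =ᶠ[𝓝 z] J := fun z hz => by
    constructor <;>
    · filter_upwards [hz] with y hy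
      rw [hy, Pi.one_apply, one_smul]
  refine ⟨fun z => η z • B z, fun z => η z • J z, fun z => m - η z * (m - q z), Φ, Ψ,
    ⟨hB, hJ, contDiff_const.sub hR, hηc.smul_right, hηc.smul_right, fun z => ?_, fun z => ?_,
      fun z => ?_, hΦ, hΨ⟩, fun z => ?_, fun z => ?_, hP0, fun y hy => ?_, fun O hO hγO => ?_⟩
  · rw [hfP, neg_apply, neg_eq_zero, map_smul]
    rcases hηB z with ⟨hz, hd, h1, -⟩ | hz
    · rw [fderiv_smul_apply_of_eq_zero hd (hdR hz) h1, fderiv_const_sub, neg_apply,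
        h.fderiv_p_B hz, neg_zero, smul_zero, smul_zero]
    · rw [fderiv_eq_zero_of_eventuallyEq_zero hz, zero_apply, smul_zero]
  · rw [hfP, neg_apply, neg_eq_zero, map_smul]
    rcases hηB z with ⟨hz, hd, -, h1⟩ | hz
    · rw [fderiv_smul_apply_of_eq_zero hd (hdR hz) h1, fderiv_const_sub, neg_apply,
        h.fderiv_p_J hz, neg_zero, smul_zero, smul_zero]
    · rw [fderiv_eq_zero_of_eventuallyEq_zero hz, zero_apply, smul_zero]
  · rw [map_smul, map_smul]
    rcases hηB z with ⟨hz, hd, h1, h2⟩ | hz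
    · rw [fderiv_smul_apply_of_eq_zero hd (h.differentiableAt_J hz) h1,
        fderiv_smul_apply_of_eq_zero hd (h.differentiableAt_B hz) h2, h.bracket hz]
    · rw [fderiv_eq_zero_of_eventuallyEq_zero hz, fderiv_eq_zero_of_eventuallyEq_zero hz,
        zero_apply, zero_apply]
  · rcases hηB z with ⟨hz, hd, h1, h2⟩ | hz
    · rw [divg_smul hd (h.differentiableAt_B hz), h.div_B z hz, h1, mul_zero, add_zero]
    · simp [divg, fderiv_eq_zero_of_eventuallyEq_zero hz]
  · rcases hηB z with ⟨hz, hd, h1, h2⟩ | hz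
    · rw [divg_smul hd (h.differentiableAt_J hz), h.div_J z hz, h2, mul_zero, add_zero]
    · simp [divg, fderiv_eq_zero_of_eventuallyEq_zero hz]
  · refine ⟨(hone y (hηγ y hy)).1, (hone y (hηγ y hy)).2, ?_⟩
    filter_upwards [hηγ y hy] with x hx
    rw [hx, Pi.one_apply, one_mul, sub_sub_cancel]
  · obtain ⟨ε, hε, hz⟩ := hbasis O hO hγO
    refine ⟨ε, hε, fun z hPz => ?_⟩
    obtain ⟨h1, h2, h3⟩ := hz z hPz
    exact ⟨h1, h2, hone z h3⟩

end IntegrableMagneticField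

end Reduction

section CircleSymmetry

open Set Filter Topology Module
open scoped ContDiff

theorem cross3_smul_add_smul (a b : ℝ) (v w : R3) :
    cross3 (a • v + b • w) w = a • cross3 v w := by
  ext i
  fin_cases i <;> simp [cross3, pt] <;> ring

theorem eq_smul_of_cross3_eq_zero {v w : R3} (hw : w ≠ 0) (h : cross3 v w = 0) :
    v = (⟪v, w⟫ / ⟪w, w⟫) • w := by
  have hww : ⟪w, w⟫ ≠ 0 := inner_self_ne_zero.2 hw
  have h0 : v 1 * w 2 - v 2 * w 1 = 0 := congrArg (fun x : R3 => x 0) h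
  have h1 : v 2 * w 0 - v 0 * w 2 = 0 := congrArg (fun x : R3 => x 1) h
  have h2 : v 0 * w 1 - v 1 * w 0 = 0 := congrArg (fun x : R3 => x 2) h
  have : ⟪w, w⟫ • v = ⟪v, w⟫ • w := by
    ext i
    simp only [PiLp.inner_apply, Fin.sum_univ_three, PiLp.smul_apply, smul_eq_mul]
    fin_cases i <;> simp
    · linear_combination w 1 * h2 - w 2 * h1
    · linear_combination w 2 * h0 - w 0 * h2
    · linear_combination w 0 * h1 - w 1 * h0
  rw [div_eq_inv_mul, mul_smul, ← this, inv_smul_smul₀ hww]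

/-- `A` restricts to a smooth volume-preserving circle action on the neighbourhood `V ⊆ U` of `γ`
whose generator `u` vanishes nowhere and commutes with `B` and `J`. -/
structure IsCircleSymmetry (U γ : Set R3) (B J : R3 → R3) (V : Set R3) (A : ℝ → R3 → R3)
    (u : R3 → R3) : Prop where
  isOpen : IsOpen V
  axis_subset : γ ⊆ V
  subset : V ⊆ U
  contDiff : ContDiff ℝ ∞ fun x : ℝ × R3 => A x.1 x.2
  mapsTo : ∀ ζ, ∀ z ∈ V, A ζ z ∈ V
  zero : ∀ z, A 0 z = z
  add : ∀ ζ ζ' z, A (ζ + ζ') z = A ζ (A ζ' z)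
  periodic : ∀ z ∈ V, A (2 * Real.pi) z = z
  det_eq_one : ∀ ζ z, LinearMap.det (fderiv ℝ (A ζ) z).toLinearMap = 1
  generator : ∀ z, HasDerivAt (fun ζ => A ζ z) (u z) 0
  contDiff_generator : ContDiff ℝ ∞ u
  generator_ne_zero : ∀ z ∈ V, u z ≠ 0
  bracket_B : ∀ z ∈ V, fderiv ℝ B z (u z) = fderiv ℝ u z (B z)
  bracket_J : ∀ z ∈ V, fderiv ℝ J z (u z) = fderiv ℝ u z (J z)

theorem IsCircleSymmetry.bijOn {U γ V : Set R3} {B J u : R3 → R3} {A : ℝ → R3 → R3}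
    (h : IsCircleSymmetry U γ B J V A u) (ζ : ℝ) : BijOn (A ζ) V V := by
  refine BijOn.mk (h.mapsTo ζ) (fun x _ y _ hxy => ?_) fun y hy => ⟨A (-ζ) y, h.mapsTo _ y hy, ?_⟩
  · rw [← h.zero x, ← h.zero y, ← neg_add_cancel ζ, h.add, h.add, hxy]
  · rw [← h.add, add_neg_cancel, h.zero]

namespace IntegrableMagneticField

variable {U : Set R3} {B J : R3 → R3} {q : R3 → ℝ}

theorem exists_isCircleSymmetry_of_pos (h : IntegrableMagneticField U B J q) {c : ℝ → R3} {T : ℝ}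
    (hT : 0 < T) (hcU : ∀ t, c t ∈ U) (hper : ∀ t, c (t + T) = c t)
    (hc : ∀ t, HasDerivAt c (B (c t)) t) (hK : IsCompact (range c)) (hJ : ∀ t, J (c t) = 0)
    (hq : ∀ t, q (c t) = 0) (hq1 : ∀ t, fderiv ℝ q (c t) = 0)
    (hq2 : ∀ t, ∀ w : R3, w ≠ 0 → ⟪w, B (c t)⟫ = 0 → 0 < fderiv ℝ (fderiv ℝ q) (c t) w w) :
    ∃ V A u, IsCircleSymmetry U (range c) B J V A u := by
  have hrU : range c ⊆ U := range_subset_iff.2 hcU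
  obtain ⟨δ, hδ, hpos⟩ := exists_pos_of_hess_pos h.isOpen_U h.smooth_p
    (h.smooth_B.continuousOn.mono hrU) hc hrU hK (forall_mem_range.2 hq) (forall_mem_range.2 hq1)
    (forall_mem_range.2 hq2)
  obtain ⟨B', J', P, Φ, Ψ, hC, hdB, hdJ, hP0, haxis, hbasis⟩ :=
    h.exists_commutingPair hK (range_nonempty c) (forall_mem_range.2 hq) hδ hpos
  rw [forall_mem_range] at haxis
  have hB' : ∀ t, B' (c t) = B (c t) := fun t => (haxis t).1.eq_of_nhds
  have hP' : ∀ t, P (c t) = 0 := fun t => (haxis t).2.2.eq_of_nhds.trans (hq t)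
  obtain ⟨L, hL⟩ := hC.exists_lipschitz
  have hcΦ : ∀ t, c t = Φ t (c 0) :=
    hC.flow_B.eq_of_hasDerivAt hL fun t => (hB' t).symm ▸ hc t
  have hg : ∀ᶠ z in 𝓝 (c 0), cross3 (J' z) (B' z) = gradient P z := by
    filter_upwards [h.eventually_hamiltonian (hcU 0), (haxis 0).1, (haxis 0).2.1,
      (haxis 0).2.2.eventuallyEq_nhds] with z h1 h2 h3 h4
    rw [h2, h3, h1, gradient, gradient, h4.fderiv_eq]
  have hQ : ∀ w : R3, w ≠ 0 → ⟪w, B' (c 0)⟫ = 0 → 0 < fderiv ℝ (fderiv ℝ P) (c 0) w w := by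
    rw [hB', (haxis 0).2.2.fderiv.fderiv_eq]
    exact hq2 0
  obtain ⟨ν, θ, e, e₂, π₁, π₂, πb, hF⟩ := exists_ellipticFrame_of_cross3 hC hT
    (by rw [← hcΦ, ← hper 0, zero_add]) (by rw [hB']; exact h.B_ne_zero _ (hcU 0))
    (by rw [(haxis 0).2.1.eq_of_nhds, hJ]) (hP' 0) hP0 hg hQ
  obtain ⟨A, u, hA, hu, hPA, hA0, hadd, ⟨ε₁, hε₁, hA2⟩, hdet, hAu, huΦ, huB, huJ⟩ :=
    hC.exists_circle_action (by simp) hF (fun O hO hΦO => by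
      obtain ⟨ε, hε, hz⟩ := hbasis O hO (range_subset_iff.2 fun t => hcΦ t ▸ hΦO t)
      exact ⟨ε, hε, fun z hPz => (hz z hPz).1⟩) hdB hdJ
  obtain ⟨ε₂, hε₂, hz⟩ := hbasis {z | u z ≠ 0} (isOpen_ne_fun hu.continuous continuous_const)
    (range_subset_iff.2 fun t => by
      rw [mem_ofPred_eq, hcΦ, huΦ, ← hcΦ, hB']
      exact smul_ne_zero (by positivity) (h.B_ne_zero _ (hcU t)))
  refine ⟨{z | P z < min ε₁ ε₂}, A, u, ?_⟩
  have hV : ∀ {z}, P z < min ε₁ ε₂ → u z ≠ 0 ∧ z ∈ U ∧ B' =ᶠ[𝓝 z] B ∧ J' =ᶠ[𝓝 z] J := fun hPz =>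
    hz _ (hPz.trans_le (min_le_right _ _))
  exact
    { isOpen := isOpen_lt hC.smooth_P.continuous continuous_const
      axis_subset := range_subset_iff.2 fun t => (hP' t).trans_lt (lt_min hε₁ hε₂)
      subset := fun z hPz => (hV hPz).2.1
      contDiff := hA
      mapsTo := fun ζ z hPz => (hPA ζ z).trans_lt hPz
      zero := hA0
      add := hadd
      periodic := fun z hPz => hA2 z (lt_of_lt_of_le hPz (min_le_left _ _))
      det_eq_one := hdet
      generator := fun z => by simpa only [hA0] using hAu 0 z
      contDiff_generator := hu
      generator_ne_zero := fun z hPz => (hV hPz).1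
      bracket_B := fun z hPz => by
        have := huB z
        rwa [(hV hPz).2.2.1.fderiv_eq, (hV hPz).2.2.1.eq_of_nhds] at this
      bracket_J := fun z hPz => by
        have := huJ z
        rwa [(hV hPz).2.2.2.fderiv_eq, (hV hPz).2.2.2.eq_of_nhds] at this }

theorem exists_eq_smul_on_axis (h : IntegrableMagneticField U B J q) {c : ℝ → R3}
    (hcU : ∀ t, c t ∈ U) (hc : ∀ t, HasDerivAt c (B (c t)) t)
    (hq1 : ∀ t, gradient q (c t) = 0) : ∃ k : ℝ, ∀ t, J (c t) = k • B (c t) := by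
  have hcomp : ∀ {f : R3 → R3} {t}, DifferentiableAt ℝ f (c t) →
      HasDerivAt (fun t => f (c t)) (fderiv ℝ f (c t) (B (c t))) t := fun {f t} hf =>
    HasFDerivAt.comp_hasDerivAt (l := f) t hf.hasFDerivAt (hc t)
  have hBd := fun t => hcomp (h.differentiableAt_B (hcU t))
  have hJd := fun t => hcomp (h.differentiableAt_J (hcU t))
  have hB0 := fun t => h.B_ne_zero _ (hcU t)
  let k : ℝ → ℝ := fun t => ⟪J (c t), B (c t)⟫ / ⟪B (c t), B (c t)⟫
  have hk : ∀ t, J (c t) = k t • B (c t) := fun t =>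
    eq_smul_of_cross3_eq_zero (hB0 t) (by rw [h.hamiltonian _ (hcU t), hq1])
  have hkd : ∀ t, DifferentiableAt ℝ k t := fun t =>
    ((hJd t).differentiableAt.inner ℝ (hBd t).differentiableAt).div
      ((hBd t).differentiableAt.inner ℝ (hBd t).differentiableAt) (inner_self_ne_zero.2 (hB0 t))
  have hk' : ∀ t, deriv k t = 0 := fun t => by
    have h1 : HasDerivAt (fun t => J (c t))
        (k t • fderiv ℝ B (c t) (B (c t)) + deriv k t • B (c t)) t :=
      ((hkd t).hasDerivAt.smul (hBd t)).congr_of_eventuallyEq (Eventually.of_forall hk)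
    have h2 := h1.unique (hJd t)
    rw [h.bracket (hcU t), hk t, map_smul, add_eq_left] at h2
    exact (smul_eq_zero.1 h2).resolve_right (hB0 t)
  refine ⟨k 0, fun t => ?_⟩
  rw [hk t, is_const_of_deriv_eq_zero (fun t => hkd t) hk' t 0]

theorem smul_add_smul (h : IntegrableMagneticField U B J q) (a b q₀ : ℝ) :
    IntegrableMagneticField U B (fun z => a • J z + b • B z) fun z => a * (q z - q₀) where
  isOpen_U := h.isOpen_U
  smooth_B := h.smooth_B
  smooth_J := (h.smooth_J.const_smul a).add (h.smooth_B.const_smul b)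
  smooth_p := contDiffOn_const.mul (h.smooth_p.sub contDiffOn_const)
  B_ne_zero := h.B_ne_zero
  div_B := h.div_B
  div_J z hz := by
    have h1 : fderiv ℝ (fun z => a • J z + b • B z) z = a • fderiv ℝ J z + b • fderiv ℝ B z :=
      (((h.differentiableAt_J hz).hasFDerivAt.const_smul a).add
        ((h.differentiableAt_B hz).hasFDerivAt.const_smul b)).fderiv
    have h2 := h.div_B z hz
    have h3 := h.div_J z hz
    rw [divg] at h2 h3 ⊢
    simp [h1, h2, h3]
  hamiltonian z hz := by
    have h1 : fderiv ℝ (fun z => a * (q z - q₀)) z = a • fderiv ℝ q z :=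
      (((h.differentiableAt_p hz).hasFDerivAt.sub_const q₀).const_mul a).fderiv
    rw [cross3_smul_add_smul, h.hamiltonian z hz, gradient, gradient, h1, map_smul]

theorem exists_isCircleSymmetry (h : IntegrableMagneticField U B J q) {c : ℝ → R3} {T : ℝ}
    (hT : 0 < T) (hcU : ∀ t, c t ∈ U) (hper : ∀ t, c (t + T) = c t)
    (hc : ∀ t, HasDerivAt c (B (c t)) t) (hK : IsCompact (range c))
    (hq1 : ∀ t, gradient q (c t) = 0) {a : ℝ} (ha : a ≠ 0)
    (hq2 : ∀ t, ∀ w : R3, w ≠ 0 → ⟪w, B (c t)⟫ = 0 → 0 < a * fderiv ℝ (fderiv ℝ q) (c t) w w) :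
    ∃ V A u, IsCircleSymmetry U (range c) B J V A u := by
  have hq1' : ∀ t, fderiv ℝ q (c t) = 0 := fun t => by
    ext w
    rw [← inner_gradient_apply, hq1, inner_zero_left, zero_apply]
  obtain ⟨k, hk⟩ := h.exists_eq_smul_on_axis hcU hc hq1
  have hqc : ∀ t, q (c t) = q (c 0) := fun t => by
    have : ∀ t, HasDerivAt (fun t => q (c t)) 0 t := fun t =>
      (HasFDerivAt.comp_hasDerivAt (l := q) t (h.differentiableAt_p (hcU t)).hasFDerivAt
        (hc t)).congr_deriv (by rw [hq1', zero_apply])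
    exact is_const_of_deriv_eq_zero (fun t => (this t).differentiableAt)
      (fun t => (this t).deriv) t 0
  have hfd : ∀ z ∈ U, fderiv ℝ (fun z => a * (q z - q (c 0))) z = a • fderiv ℝ q z := fun z hz =>
    (((h.differentiableAt_p hz).hasFDerivAt.sub_const _).const_mul a).fderiv
  have hfd2 : ∀ t, fderiv ℝ (fderiv ℝ fun z => a * (q z - q (c 0))) (c t) =
      a • fderiv ℝ (fderiv ℝ q) (c t) := fun t => by
    have : fderiv ℝ (fun z => a * (q z - q (c 0))) =ᶠ[𝓝 (c t)] fun z => a • fderiv ℝ q z :=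
      Filter.mem_of_superset (h.isOpen_U.mem_nhds (hcU t)) hfd
    rw [this.fderiv_eq]
    exact ((h.differentiableAt_fderiv_p (hcU t)).hasFDerivAt.const_smul a).fderiv
  obtain ⟨V, A, u, hS⟩ := (h.smul_add_smul a (-(a * k)) (q (c 0))).exists_isCircleSymmetry_of_pos
    hT hcU hper hc hK (fun t => by rw [hk, smul_smul, neg_smul, add_neg_cancel])
    (fun t => by rw [hqc, sub_self, mul_zero])
    (fun t => by rw [hfd _ (hcU t), hq1', smul_zero]) (fun t w hw hwB => by
      rw [hfd2]
      exact hq2 t w hw hwB)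
  refine ⟨V, A, u, { hS with bracket_J := fun z hz => ?_ }⟩
  have hzU := hS.subset hz
  have h1 : fderiv ℝ (fun z => a • J z + (-(a * k)) • B z) z =
      a • fderiv ℝ J z + (-(a * k)) • fderiv ℝ B z :=
    (((h.differentiableAt_J hzU).hasFDerivAt.const_smul a).add
      ((h.differentiableAt_B hzU).hasFDerivAt.const_smul (-(a * k)))).fderiv
  have h2 := hS.bracket_J z hz
  rw [h1, add_apply, smul_apply, smul_apply, hS.bracket_B z hz, map_add, map_smul, map_smul,
    add_left_inj] at h2
  exact smul_right_injective _ ha h2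

theorem exists_sign (h : IntegrableMagneticField U B J q) {c : ℝ → R3}
    (hcU : ∀ t, c t ∈ U) (hc : ∀ t, HasDerivAt c (B (c t)) t)
    (hq1 : ∀ t, gradient q (c t) = 0)
    (hq2 : ∀ t, (∀ w : R3, w ≠ 0 → ⟪w, B (c t)⟫ = 0 → 0 < fderiv ℝ (fderiv ℝ q) (c t) w w) ∨
      ∀ w : R3, w ≠ 0 → ⟪w, B (c t)⟫ = 0 → fderiv ℝ (fderiv ℝ q) (c t) w w < 0) :
    ∃ a : ℝ, a ≠ 0 ∧ ∀ t, ∀ w : R3, w ≠ 0 → ⟪w, B (c t)⟫ = 0 →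
      0 < a * fderiv ℝ (fderiv ℝ q) (c t) w w := by
  have hq1' : ∀ t, fderiv ℝ q (c t) = 0 := fun t => by
    ext w
    rw [← inner_gradient_apply, hq1, inner_zero_left, zero_apply]
  let Q := fun t => fderiv ℝ (fderiv ℝ q) (c t)
  have hsymm : ∀ t v w, Q t v w = Q t w v := fun t v w =>
    second_derivative_symmetric_of_eventually
      (Filter.mem_of_superset (h.isOpen_U.mem_nhds (hcU t))
        fun y hy => (h.differentiableAt_p hy).hasFDerivAt)
      (h.differentiableAt_fderiv_p (hcU t)).hasFDerivAt v w
  have hQB : ∀ t v, Q t v (B (c t)) = 0 := fun t v => by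
    have h1 : HasDerivAt (fun t => fderiv ℝ q (c t)) (Q t (B (c t))) t :=
      HasFDerivAt.comp_hasDerivAt (l := fderiv ℝ q) t
        (h.differentiableAt_fderiv_p (hcU t)).hasFDerivAt (hc t)
    have h2 : Q t (B (c t)) = 0 :=
      h1.unique ((hasDerivAt_const t 0).congr_of_eventuallyEq (Eventually.of_forall hq1'))
    rw [hsymm, h2, zero_apply]
  let g := fun t => Q t (e3 0) (e3 0) + Q t (e3 1) (e3 1) + Q t (e3 2) (e3 2)
  have hQc : Continuous Q :=
    (h.smooth_p.fderiv_of_isOpen (m := ∞) h.isOpen_U (by simp)).fderiv_of_isOpen (m := ∞)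
      h.isOpen_U (by simp) |>.continuousOn.comp_continuous
      (continuous_iff_continuousAt.2 fun t => (hc t).continuousAt) hcU
  have hgc : Continuous g := by fun_prop
  have hB0 := fun t => h.B_ne_zero _ (hcU t)
  have hp : ∀ t, (∀ w : R3, w ≠ 0 → ⟪w, B (c t)⟫ = 0 → 0 < Q t w w) → 0 < g t := fun t ht =>
    sum_apply_pos_of_pos_on_orthogonal (hB0 t) (hsymm t) (hQB t) ht
  have hn : ∀ t, (∀ w : R3, w ≠ 0 → ⟪w, B (c t)⟫ = 0 → Q t w w < 0) → g t < 0 := fun t ht => by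
    have := sum_apply_pos_of_pos_on_orthogonal (Q := -Q t) (hB0 t)
      (fun v w => by simp only [neg_apply, hsymm t v w])
      (fun v => by simp only [neg_apply, hQB, neg_zero])
      fun w hw hwB => by simpa using ht w hw hwB
    simp only [neg_apply] at this
    simp only [g]
    linarith
  have hsame : ∀ s t, g s < 0 → 0 < g t → False := fun s t hs ht => by
    obtain ⟨r, hr⟩ := mem_range_of_exists_le_of_exists_ge hgc ⟨s, hs.le⟩ ⟨t, ht.le⟩
    rcases hq2 r with h' | h'
    · exact (hp r h').ne' hr
    · exact (hn r h').ne hr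
  rcases hq2 0 with h0 | h0
  · refine ⟨1, one_ne_zero, fun t w hw hwB => ?_⟩
    rw [one_mul]
    rcases hq2 t with h' | h'
    · exact h' w hw hwB
    · exact (hsame t 0 (hn t h') (hp 0 h0)).elim
  · refine ⟨-1, by norm_num, fun t w hw hwB => ?_⟩
    rcases hq2 t with h' | h'
    · exact (hsame 0 t (hn 0 h0) (hp t h')).elim
    · linarith [h' w hw hwB]

end IntegrableMagneticField

end CircleSymmetry

/-- **Existence of a volume-preserving circle symmetry near an elliptic axis**
(Corollary of near-axis Hamada coordinates). -/
theorem circle_symmetry_near_elliptic_axis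
    (U : Set R3) (B J : R3 → R3) (p : R3 → ℝ) (γ : Set R3)
    (hBJp : IntegrableMagneticField U B J p)
    (hγ : IsNondegenerateEllipticAxis U B p γ) :
    ∃ (𝒰 : Set R3) (T : ℝ → R3 → R3) (u : R3 → R3),
      IsOpen 𝒰 ∧ γ ⊆ 𝒰 ∧ 𝒰 ⊆ U ∧
      -- T is a C^∞ map ℝ × 𝒰 → 𝒰
      ContDiffOn ℝ (⊤ : ℕ∞) (fun q : ℝ × R3 => T q.1 q.2) (Set.univ ×ˢ 𝒰) ∧
      (∀ ζ : ℝ, ∀ z ∈ 𝒰, T ζ z ∈ 𝒰) ∧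
      -- group action properties
      (∀ z ∈ 𝒰, T 0 z = z) ∧
      (∀ ζ ζ' : ℝ, ∀ z ∈ 𝒰, T (ζ + ζ') z = T ζ (T ζ' z)) ∧
      (∀ z ∈ 𝒰, T (2 * Real.pi) z = z) ∧
      -- each T ζ is a (volume-preserving) diffeomorphism of 𝒰
      (∀ ζ : ℝ, Set.BijOn (T ζ) 𝒰 𝒰) ∧
      (∀ ζ : ℝ, ∀ z ∈ 𝒰, LinearMap.det (fderiv ℝ (T ζ) z).toLinearMap = 1) ∧
      -- u is the infinitesimal generator of T
      (∀ z ∈ 𝒰, HasDerivAt (fun ζ => T ζ z) (u z) 0) ∧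
      -- u is C^∞ and nowhere vanishing, and commutes with B and J
      ContDiffOn ℝ (⊤ : ℕ∞) u 𝒰 ∧
      (∀ z ∈ 𝒰, u z ≠ 0) ∧
      (∀ z ∈ 𝒰, (fderiv ℝ B z) (u z) - (fderiv ℝ u z) (B z) = 0) ∧
      (∀ z ∈ 𝒰, (fderiv ℝ J z) (u z) - (fderiv ℝ u z) (J z) = 0) := by
  obtain ⟨hK, -, ⟨c, T, hT, hcU, hper, hc, rfl⟩, hp1, hp2⟩ := hγ
  rw [Set.forall_mem_range] at hp1 hp2
  simp only [hess, iteratedFDeriv_two_apply, Matrix.cons_val_zero, Matrix.cons_val_one] at hp2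
  obtain ⟨a, ha, hpa⟩ := hBJp.exists_sign hcU hc hp1 hp2
  obtain ⟨V, A, u, h⟩ := hBJp.exists_isCircleSymmetry hT hcU hper hc hK hp1 ha hpa
  exact ⟨V, A, u, h.isOpen, h.axis_subset, h.subset, h.contDiff.contDiffOn, h.mapsTo,
    fun z _ => h.zero z, fun ζ ζ' z _ => h.add ζ ζ' z, h.periodic, h.bijOn,
    fun ζ z _ => h.det_eq_one ζ z, fun z _ => h.generator z, h.contDiff_generator.contDiffOn,
    h.generator_ne_zero, fun z hz => sub_eq_zero.2 (h.bracket_B z hz),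
    fun z hz => sub_eq_zero.2 (h.bracket_J z hz)⟩
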